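/- arXiv:2602.16152 — 2 statements merged into one kernel-verified Lean document; each statement's English description precedes it below -/
import Mathlib

section
/- For every n ≥ 7, every smallest string attractor of the Fibonacci word F_n belongs to the set ((L_{n-3} ∪ R_{n-3}) ⊗ L_{n-2}) ∪ (L'_{n-3} ⊗ R_{n-2}); i.e., Att(F_n) ⊆ ((L_{n-3} ∪ R_{n-3}) ⊗ L_{n-2}) ∪ (L'_{n-3} ⊗ R_{n-2}). -/
/-- Fibonacci numbers: f 0 = f 1 = 1, f (n+2) = f (n+1) + f n. -/
def fib : ℕ → ℕ
  | 0 => 1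
  | 1 => 1
  | n + 2 => fib (n + 1) + fib n

/-- Fibonacci words over {a, b}; `false` encodes `a`, `true` encodes `b`. -/
def F : ℕ → List Bool
  | 0 => [true]
  | 1 => [false]
  | n + 2 => F (n + 1) ++ F n

/-- Singular words: S 0 = a, S 1 = b, S 2 = S 0 · S₋₁ · S 0 = aa,
and S n = S (n-2) · S (n-3) · S (n-2) for n ≥ 3. -/
def S : ℕ → List Bool
  | 0 => [false]
  | 1 => [true]
  | 2 => [false, false]
  | n + 3 => S (n + 1) ++ S n ++ S (n + 1)

/-- `w` occurs in `T` at (1-based) position `i`, i.e. `w = T[i .. i + |w| - 1]`. -/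
def OccursAt {α : Type*} (T w : List α) (i : ℕ) : Prop :=
  1 ≤ i ∧ i + w.length ≤ T.length + 1 ∧ (T.drop (i - 1)).take w.length = w

/-- `Γ` is a string attractor of `T`: a set of (1-based) positions of `T` such that
every nonempty substring of `T` has an occurrence crossing a position of `Γ`. -/
def IsAttractor {α : Type*} (T : List α) (Γ : Finset ℕ) : Prop :=
  (∀ k ∈ Γ, 1 ≤ k ∧ k ≤ T.length) ∧
  ∀ w : List α, w ≠ [] → w <:+: T →
    ∃ i, OccursAt T w i ∧ ∃ k ∈ Γ, i ≤ k ∧ k < i + w.length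

/-- `Γ` is a smallest string attractor of `T`. -/
def IsSmallestAttractor {α : Type*} (T : List α) (Γ : Finset ℕ) : Prop :=
  IsAttractor T Γ ∧ ∀ Γ' : Finset ℕ, IsAttractor T Γ' → Γ.card ≤ Γ'.card

/-- The set of all smallest string attractors of `T`. -/
def Att {α : Type*} (T : List α) : Set (Finset ℕ) := {Γ | IsSmallestAttractor T Γ}

/-- The position sets L_k: L_2 = {3}, L_3 = {5},
L_k = (L_{k-2} ∪ R_{k-2}) ⊕ f_k for k ≥ 4 (with R_{k-2} = L_{k-2} ⊕ f_{k-3}). -/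
def Lset : ℕ → Finset ℕ
  | 0 => ∅
  | 1 => ∅
  | 2 => {3}
  | 3 => {5}
  | k + 4 => ((Lset (k + 2)) ∪ (Lset (k + 2)).image (· + fib (k + 1))).image (· + fib (k + 4))

/-- The position sets R_k = L_k ⊕ f_{k-1} (so R_2 = {4}, R_3 = {7}). -/
def Rset (k : ℕ) : Finset ℕ := (Lset k).image (· + fib (k - 1))

/-- The position sets L'_k: L'_2 = {3, 4}, L'_3 = {5}, L'_k = L'_{k-2} ⊕ f_k for k ≥ 4. -/
def L'set : ℕ → Finset ℕ
  | 0 => ∅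
  | 1 => ∅
  | 2 => {3, 4}
  | 3 => {5}
  | k + 4 => (L'set (k + 2)).image (· + fib (k + 4))

/-- X ⊗ Y := { {x, y} : x ∈ X, y ∈ Y }. -/
def pairSet (X Y : Finset ℕ) : Set (Finset ℕ) := {Γ | ∃ x ∈ X, ∃ y ∈ Y, Γ = {x, y}}


/-! ### The infinite Fibonacci word as a function -/

theorem fib_add_two (n : ℕ) : fib (n + 2) = fib (n + 1) + fib n := rfl

theorem fib_pos (n : ℕ) : 1 ≤ fib n := by
  induction n using Nat.twoStepInduction with
  | zero => simp [fib]
  | one => simp [fib]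
  | more n h1 h2 => rw [fib_add_two]; omega

theorem lt_fib_succ (n : ℕ) : n < fib (n + 1) := by
  induction n with
  | zero => simp [fib]
  | succ n ih => rw [fib_add_two]; have := fib_pos n; omega

theorem length_F (n : ℕ) : (F n).length = fib n := by
  induction n using Nat.twoStepInduction with
  | zero => simp [fib, F]
  | one => simp [fib, F]
  | more n h1 h2 => simp only [F, fib, List.length_append, h1, h2]

theorem F_prefix (n d : ℕ) : F (n + 1) <+: F (n + 1 + d) := by
  induction d with
  | zero => exact List.prefix_refl _
  | succ d ih =>
    refine ih.trans ?_
    rw [show n + 1 + (d + 1) = (n + d) + 2 by omega, show n + 1 + d = n + d + 1 by omega]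
    exact List.prefix_append _ _

/-- letters of the infinite Fibonacci word, indexed from 0 -/
def W (i : ℕ) : Bool := (F (i + 1)).getD i false

theorem F_get (n i : ℕ) (h : i < fib (n + 1)) : (F (n + 1))[i]? = some (W i) := by
  have h1 : i < (F (i + 1)).length := by rw [length_F]; exact lt_fib_succ i
  have h2 : (F (i + 1))[i]? = some (W i) := by
    unfold W
    rw [List.getD_eq_getElem?_getD, List.getElem?_eq_getElem h1]; rfl
  rcases le_total n i with hn | hn
  · obtain ⟨d, rfl⟩ := Nat.exists_eq_add_of_le hn
    obtain ⟨t, ht⟩ := F_prefix n d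
    rw [← h2, show n + d + 1 = n + 1 + d by omega, ← ht, List.getElem?_append_left]
    rw [length_F]; exact h
  · obtain ⟨d, rfl⟩ := Nat.exists_eq_add_of_le hn
    obtain ⟨t, ht⟩ := F_prefix i d
    rw [← h2, show i + d + 1 = i + 1 + d by omega, ← ht, List.getElem?_append_left]
    exact h1

theorem W_zero : W 0 = false := by simp [W, F]
theorem W_one : W 1 = true := by simp [W, F]

theorem W_shift (n i : ℕ) (h : i < fib (n + 1)) : W (fib (n + 2) + i) = W i := by
  have h1 := F_get (n + 2) (fib (n + 2) + i) (by
    have : fib (n + 2 + 1) = fib (n + 2) + fib (n + 1) := rfl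
    omega)
  have h2 := F_get n i h
  rw [show F (n + 2 + 1) = F (n + 2) ++ F (n + 1) from rfl,
    List.getElem?_append_right (by rw [length_F]; omega), length_F, Nat.add_sub_cancel_left,
    h2] at h1
  exact (Option.some.inj h1).symm

/-- near-commutation -/
theorem W_shift' (n i : ℕ) (h : i + 2 < fib (n + 3)) : W (fib (n + 2) + i) = W i := by
  induction n generalizing i with
  | zero => simp only [fib] at h; exact W_shift 0 i (by simp only [fib]; omega)
  | succ n ih =>
    have e1 := fib_add_two (n + 2)
    have e2 := fib_add_two (n + 1)
    by_cases hi : i < fib (n + 2)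
    · exact W_shift (n + 1) i hi
    · obtain ⟨j, rfl⟩ := Nat.exists_eq_add_of_le (not_lt.mp hi)
      have h1 : W (fib (n + 4) + j) = W j := W_shift (n + 2) j (by
        have : fib (n + 2 + 1) = fib (n + 3) := rfl
        have : fib (n + 1 + 3) = fib (n + 3) + fib (n + 2) := rfl
        omega)
      have h2 := ih j (by
        have : fib (n + 1 + 3) = fib (n + 3) + fib (n + 2) := rfl
        omega)
      rw [h2, ← h1]
      congr 1
      have : fib (n + 4) = fib (n + 3) + fib (n + 2) := rfl
      have : fib (n + 1 + 2) = fib (n + 3) := rfl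
      omega

theorem W_last (n : ℕ) : (if W (fib (n + 1) - 1) then (1 : ℝ) else 0) = (1 - (-1) ^ n) / 2 := by
  induction n using Nat.twoStepInduction with
  | zero => simp [fib, W_zero]
  | one => simp [fib, W_one]
  | more n h1 h2 =>
    have := W_shift n (fib (n + 1) - 1) (by have := fib_pos (n + 1); omega)
    have e : fib (n + 2 + 1) - 1 = fib (n + 2) + (fib (n + 1) - 1) := by
      have := fib_pos (n + 1)
      have : fib (n + 2 + 1) = fib (n + 2) + fib (n + 1) := rfl
      omega
    rw [e, this, h1, pow_add]; norm_num

theorem W_last_eq (n : ℕ) : W (fib (n + 3) - 1) = W (fib (n + 1) - 1) := by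
  have := W_shift n (fib (n + 1) - 1) (by have := fib_pos (n + 1); omega)
  rw [← this]
  congr 1
  have := fib_pos (n + 1)
  have : fib (n + 3) = fib (n + 2) + fib (n + 1) := rfl
  omega

/-! ### The golden rotation -/

noncomputable def gam : ℝ := (Real.sqrt 5 - 1) / 2

theorem gam_sq : gam ^ 2 = 1 - gam := by
  have h := Real.sq_sqrt (show (0 : ℝ) ≤ 5 by norm_num)
  unfold gam; nlinarith

theorem gam_pos : 0 < gam := by
  have h := Real.sq_sqrt (show (0 : ℝ) ≤ 5 by norm_num)
  have h0 := Real.sqrt_nonneg 5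
  unfold gam; nlinarith

theorem gam_lt : gam < 1 := by
  have := gam_sq
  have := gam_pos
  nlinarith

theorem gam_pow (n : ℕ) : gam ^ (n + 2) = gam ^ n - gam ^ (n + 1) := by
  rw [pow_add, gam_sq]; ring

noncomputable def rr (i : ℕ) : ℝ :=
  ∑ k ∈ Finset.range i, (gam ^ 2 - if W k then (1 : ℝ) else 0)

theorem rr_zero : rr 0 = 0 := by simp [rr]

theorem rr_succ (i : ℕ) : rr (i + 1) = rr i + (gam ^ 2 - if W i then (1 : ℝ) else 0) := by
  exact Finset.sum_range_succ _ _

theorem rr_copy (i j l : ℕ) (h : ∀ k < l, W (i + k) = W (j + k)) :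
    rr (i + l) - rr i = rr (j + l) - rr j := by
  induction l with
  | zero => simp
  | succ l ih =>
    have h1 := ih fun k hk => h k (by omega)
    rw [← add_assoc, ← add_assoc, rr_succ, rr_succ, h l (by omega)]
    linarith

theorem rr_int (i : ℕ) : ∃ l : ℤ, rr i = i * gam ^ 2 - l := by
  induction i with
  | zero => exact ⟨0, by simp [rr]⟩
  | succ i ih =>
    obtain ⟨l, hl⟩ := ih
    refine ⟨l + if W i then 1 else 0, ?_⟩
    rw [rr_succ, hl]
    split_ifs <;> push_cast <;> ring

theorem rr_shift (n i : ℕ) (h : i ≤ fib (n + 1)) :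
    rr (fib (n + 2) + i) = rr (fib (n + 2)) + rr i := by
  have := rr_copy (fib (n + 2)) 0 i fun k hk => by
    rw [W_shift n k (by omega)]; simp
  rw [rr_zero] at this
  simp only [zero_add] at this
  linarith

theorem rr_fib (n : ℕ) : rr (fib (n + 1)) = (-gam) ^ (n + 2) := by
  have hg := gam_sq
  induction n using Nat.twoStepInduction with
  | zero => simp [fib, rr, W_zero]
  | one =>
    simp only [fib, rr, Finset.sum_range_succ, W_zero, W_one]
    simp
    have : gam ^ 3 = gam * gam ^ 2 := by ring
    rw [show (-gam) ^ 3 = - (gam * gam ^ 2) by ring, hg]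
    nlinarith
  | more n h1 h2 =>
    have := rr_shift n (fib (n + 1)) le_rfl
    rw [show fib (n + 2 + 1) = fib (n + 2) + fib (n + 1) from rfl, this, h1,
      show n + 2 = n + 1 + 1 from rfl, h2]
    rw [show n + 1 + 1 + 2 = (n + 2) + 2 by omega, pow_add _ (n + 2) 2,
      show n + 1 + 2 = (n + 2) + 1 by omega, pow_succ, neg_sq, hg]
    ring

theorem rr_bound (n i : ℕ) (h : i < fib (n + 1)) :
    -gam ^ 2 + gam ^ (n + 2) ≤ rr i ∧ rr i ≤ gam - gam ^ (n + 2) := by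
  have hg := gam_sq
  have hp := gam_pos
  have h1 := gam_lt
  induction n using Nat.twoStepInduction generalizing i with
  | zero =>
    simp only [fib] at h
    obtain rfl : i = 0 := by omega
    rw [rr_zero]
    constructor <;> simp only [zero_add] <;> nlinarith
  | one =>
    simp only [fib] at h
    have h3 : gam ^ (1 + 2) = 2 * gam - 1 := by
      rw [show gam ^ (1 + 2) = gam * gam ^ 2 by ring, hg]; nlinarith
    rw [h3, hg]
    have : i = 0 ∨ i = 1 := by omega
    rcases this with rfl | rfl
    · rw [rr_zero]; constructor <;> nlinarith
    · rw [rr_succ, rr_zero, W_zero, hg]; simp only [Bool.false_eq_true, if_false]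
      constructor <;> nlinarith
  | more n ih1 ih2 =>
    have e1 : gam ^ (n + 2 + 2) = gam ^ (n + 2) - gam ^ (n + 3) := gam_pow (n + 2)
    have e2 : gam ^ (n + 3) ≤ gam ^ (n + 2) :=
      pow_le_pow_of_le_one hp.le h1.le (by omega)
    have e3 : gam ^ (n + 2 + 2) ≤ gam ^ (n + 3) :=
      pow_le_pow_of_le_one hp.le h1.le (by omega)
    by_cases hi : i < fib (n + 2)
    · have := ih2 i hi
      rw [show n + 1 + 2 = n + 3 by omega] at this
      constructor <;> linarith [this.1, this.2]
    · obtain ⟨j, rfl⟩ := Nat.exists_eq_add_of_le (not_lt.mp hi)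
      have hj : j < fib (n + 1) := by
        have : fib (n + 2 + 1) = fib (n + 2) + fib (n + 1) := rfl
        omega
      have h4 := ih1 j hj
      have h5 : |(-gam) ^ (n + 3)| ≤ gam ^ (n + 3) := by
        rw [abs_pow, abs_neg, abs_of_pos hp]
      rw [abs_le] at h5
      rw [rr_shift n j hj.le, show n + 2 = n + 1 + 1 from rfl, rr_fib,
        show n + 1 + 2 = n + 3 by omega]
      rw [show n + 2 + 2 = n + 1 + 1 + 2 by omega] at e1
      constructor <;> linarith [h4.1, h4.2, h5.1, h5.2]

theorem rr_lt (i : ℕ) : -gam ^ 2 < rr i ∧ rr i < gam := by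
  have h := rr_bound i i (lt_fib_succ i)
  have := pow_pos gam_pos (i + 2)
  constructor <;> linarith [h.1, h.2]

/-! ### Best approximation -/

theorem decomp (m : ℕ) (k l : ℤ) : ∃ x y : ℤ, k = x * fib m + y * fib (m + 1) ∧
    (k * gam ^ 2 - l : ℝ) = x * (-gam) ^ (m + 1) + y * (-gam) ^ (m + 2) := by
  have hg := gam_sq
  induction m with
  | zero =>
    refine ⟨l, k - l, by simp [fib], ?_⟩
    push_cast
    simp only [pow_one, neg_sq]
    rw [hg]; ring
  | succ m ih =>
    obtain ⟨x, y, h1, h2⟩ := ih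
    refine ⟨y - x, x, ?_, ?_⟩
    · rw [h1, fib_add_two m]; push_cast; ring
    · rw [h2, pow_add _ (m + 1) 2, neg_sq, hg]
      rw [show m + 2 = m + 1 + 1 by omega, pow_succ _ (m + 1)]
      push_cast
      have : (-gam) ^ (m + 1 + 2) = (-gam) ^ (m + 1) * (1 - gam) := by
        rw [pow_add _ (m + 1) 2, neg_sq, hg]
      ring

theorem best (m : ℕ) (k l : ℤ) (h0 : 0 < k) (h1 : k < fib (m + 1)) :
    (-1) ^ m * (k * gam ^ 2 - l : ℝ) ≤ -gam ^ (m + 1) ∨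
      gam ^ m ≤ (-1) ^ m * (k * gam ^ 2 - l : ℝ) := by
  obtain ⟨x, y, hk, hv⟩ := decomp m k l
  have hv' : (-1) ^ m * (k * gam ^ 2 - l : ℝ) = -x * gam ^ (m + 1) + y * gam ^ (m + 2) := by
    have hs : ((-1 : ℝ) ^ m) * (-1) ^ m = 1 := by rw [← mul_pow]; norm_num
    rw [hv, neg_pow gam (m + 1), neg_pow gam (m + 2), pow_succ (-1 : ℝ) m, pow_add (-1 : ℝ) m 2]
    linear_combination (-x * gam ^ (m + 1) + y * gam ^ (m + 2)) * hs
  rw [hv']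
  have p1 := pow_pos gam_pos (m + 1)
  have p2 := pow_pos gam_pos (m + 2)
  have p3 := gam_pow m
  have f0 : (1 : ℤ) ≤ fib m := by exact_mod_cast fib_pos m
  have f1 : (1 : ℤ) ≤ fib (m + 1) := by exact_mod_cast fib_pos (m + 1)
  rcases le_or_gt y 0 with hy | hy
  · left
    have hx : 1 ≤ x := by
      by_contra hx
      have : x ≤ 0 := by omega
      nlinarith
    have hx' : (1 : ℝ) ≤ x := by exact_mod_cast hx
    have hy' : (y : ℝ) ≤ 0 := by exact_mod_cast hy
    nlinarith
  · right
    have hx : x ≤ -1 := by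
      by_contra hx
      have : 0 ≤ x := by omega
      nlinarith
    have hx' : (x : ℝ) ≤ -1 := by exact_mod_cast hx
    have hy' : (1 : ℝ) ≤ y := by exact_mod_cast hy
    nlinarith

/-! ### Occurrences of singular words -/

/-- the `m`-th singular word occurs at (0-based) position `i` of the infinite word -/
def Occ (m i : ℕ) : Prop := ∀ k < fib m, W (i + k) = W (fib (m + 1) - 1 + k)

theorem occ_self (m : ℕ) : Occ m (fib (m + 1) - 1) := fun _ _ => rfl

theorem occ_left {m i : ℕ} (hm : 1 ≤ m) (h : Occ (m + 2) i) : Occ m i := by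
  obtain ⟨m, rfl⟩ := Nat.exists_eq_add_of_le' hm
  intro k hk
  have e1 : fib (m + 1 + 2) = fib (m + 2) + fib (m + 1) := rfl
  have p1 := fib_pos (m + 1 + 2 + 1)
  have p2 := fib_pos (m + 1 + 1)
  rw [h k (by omega)]
  rcases k with _ | k
  · exact W_last_eq (m + 1)
  · have h1 := W_shift (m + 2) k (by have : fib (m + 2 + 1) = fib (m + 2) + fib (m + 1) := rfl
                                     omega)
    have h2 := W_shift m k (by omega)
    rw [show fib (m + 1 + 2 + 1) - 1 + (k + 1) = fib (m + 2 + 2) + k by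
        have : fib (m + 1 + 2 + 1) = fib (m + 2 + 2) := rfl
        omega, h1, ← h2]
    congr 1
    have : fib (m + 1 + 1) = fib (m + 2) := rfl
    omega

theorem occ_right {m i : ℕ} (h : Occ (m + 2) i) : Occ m (i + fib (m + 1)) := by
  intro k hk
  have e1 : fib (m + 2) = fib (m + 1) + fib m := rfl
  have p1 := fib_pos (m + 2 + 1)
  have p2 := fib_pos (m + 1)
  have h1 := h (fib (m + 1) + k) (by omega)
  rw [add_assoc, h1, ← W_shift (m + 1) (fib (m + 1) - 1 + k) (by
    have : fib (m + 1 + 1) = fib (m + 1) + fib m := rfl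
    omega)]
  congr 1
  have : fib (m + 1 + 2) = fib (m + 2 + 1) := rfl
  omega

theorem occ_diff {m i : ℕ} (h : Occ m i) :
    (-1) ^ m * (rr (i + fib m) - rr i) = 1 - gam ^ (m + 1) := by
  have hg := gam_sq
  rw [rr_copy _ _ _ h]
  have p1 := fib_pos (m + 1)
  have p2 := fib_pos (m + 2)
  have e1 : fib (m + 2) = fib (m + 1) + fib m := rfl
  have h1 := rr_succ (fib (m + 1) - 1)
  have h2 := rr_succ (fib (m + 2) - 1)
  rw [W_last, Nat.sub_add_cancel p1, rr_fib] at h1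
  rw [W_last (m + 1), Nat.sub_add_cancel p2, rr_fib (m + 1)] at h2
  rw [show fib (m + 1) - 1 + fib m = fib (m + 2) - 1 by omega]
  have hs : ((-1 : ℝ) ^ m) * (-1) ^ m = 1 := by rw [← mul_pow]; norm_num
  have h3 : rr (fib (m + 2) - 1) - rr (fib (m + 1) - 1)
      = (-gam) ^ (m + 1 + 2) - (-gam) ^ (m + 2) + (-1) ^ m := by
    rw [pow_succ (-1 : ℝ) m] at h2
    linarith
  rw [h3, neg_pow gam (m + 1 + 2), neg_pow gam (m + 2), show m + 1 + 2 = m + 3 by omega,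
    pow_add (-1 : ℝ) m 3, pow_add (-1 : ℝ) m 2]
  have e3 : gam ^ (m + 3) = gam ^ (m + 1) - gam ^ (m + 2) := gam_pow (m + 1)
  rw [e3]
  linear_combination (1 - gam ^ (m + 1)) * hs

theorem occ_even {m i : ℕ} (h : Occ m i) (hm : (-1 : ℝ) ^ m = 1) :
    -gam ^ 2 < rr i ∧ rr i < -gam ^ 2 + gam ^ (m + 1) := by
  have h1 := occ_diff h
  have h2 := rr_lt i
  have h3 := rr_lt (i + fib m)
  have hg := gam_sq
  rw [hm] at h1
  constructor <;> linarith [h2.1, h3.2]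

theorem occ_odd {m i : ℕ} (h : Occ m i) (hm : (-1 : ℝ) ^ m = -1) :
    gam - gam ^ (m + 1) < rr i ∧ rr i < gam := by
  have h1 := occ_diff h
  have h2 := rr_lt i
  have h3 := rr_lt (i + fib m)
  have hg := gam_sq
  rw [hm] at h1
  constructor <;> linarith [h2.2, h3.1]

theorem rr_sub {i j : ℕ} : ∃ l : ℤ, rr j - rr i = (((j : ℤ) - (i : ℤ) : ℤ) : ℝ) * gam ^ 2 - l := by
  obtain ⟨a, ha⟩ := rr_int i
  obtain ⟨b, hb⟩ := rr_int j
  refine ⟨b - a, ?_⟩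
  rw [ha, hb]; push_cast; ring

theorem occ_self_gap {m i j : ℕ} (hi : Occ m i) (hj : Occ m j) (hij : i < j) :
    i + fib (m + 1) ≤ j := by
  by_contra hc
  obtain ⟨l, hl⟩ := @rr_sub i j
  have p1 : gam ^ (m + 1) ≤ gam ^ m :=
    pow_le_pow_of_le_one gam_pos.le gam_lt.le (by omega)
  have hb := best m ((j : ℤ) - i) l (by omega) (by omega)
  rw [← hl] at hb
  rcases neg_one_pow_eq_or ℝ m with hm | hm
  · have h1 := occ_even hi hm
    have h2 := occ_even hj hm
    rw [hm] at hb
    rcases hb with hb | hb <;> linarith [h1.1, h1.2, h2.1, h2.2]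
  · have h1 := occ_odd hi hm
    have h2 := occ_odd hj hm
    rw [hm] at hb
    rcases hb with hb | hb <;> linarith [h1.1, h1.2, h2.1, h2.2]

/-- occurrences of consecutive singular words are disjoint -/
theorem occ_disj {m i j : ℕ} (hm1 : 1 ≤ m) (hi : Occ m i) (hj : Occ (m + 1) j) :
    i + fib m ≤ j ∨ j + fib (m + 1) ≤ i := by
  by_contra! hc
  obtain ⟨hc1, hc2⟩ := hc
  have hg := gam_sq
  have p1 : gam ^ (m + 2) = gam ^ m - gam ^ (m + 1) := gam_pow m
  have p0 : gam ^ m ≤ 1 := pow_le_one₀ gam_pos.le gam_lt.le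
  rcases lt_trichotomy i j with hij | hij | hij
  · obtain ⟨m, rfl⟩ := Nat.exists_eq_add_of_le' hm1
    obtain ⟨l, hl⟩ := @rr_sub i j
    have p3 : gam ^ (m + 1) ≤ gam ^ m :=
      pow_le_pow_of_le_one gam_pos.le gam_lt.le (by omega)
    rcases neg_one_pow_eq_or ℝ (m + 1) with hm | hm
    · have h1 := occ_even hi hm
      have h2 := occ_odd hj (by rw [pow_succ, hm]; norm_num)
      have hm' : (-1 : ℝ) ^ m = -1 := by rw [pow_succ] at hm; linarith
      have hb := best m ((j : ℤ) - i) (l + 1) (by omega) (by omega)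
      push_cast at hb hl
      rw [hm', ← sub_sub, ← hl] at hb
      rcases hb with hb | hb <;> linarith [h1.1, h1.2, h2.1, h2.2]
    · have h1 := occ_odd hi hm
      have h2 := occ_even hj (by rw [pow_succ, hm]; norm_num)
      have hm' : (-1 : ℝ) ^ m = 1 := by rw [pow_succ] at hm; linarith
      have hb := best m ((j : ℤ) - i) (l - 1) (by omega) (by omega)
      push_cast at hb hl
      rw [hm', ← sub_add, ← hl] at hb
      rcases hb with hb | hb <;> linarith [h1.1, h1.2, h2.1, h2.2]
  · subst hij
    rcases neg_one_pow_eq_or ℝ m with hm | hm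
    · have h1 := occ_even hi hm
      have h2 := occ_odd hj (by rw [pow_succ, hm]; norm_num)
      linarith [h1.1, h1.2, h2.1, h2.2]
    · have h1 := occ_odd hi hm
      have h2 := occ_even hj (by rw [pow_succ, hm]; norm_num)
      linarith [h1.1, h1.2, h2.1, h2.2]
  · obtain ⟨l, hl⟩ := @rr_sub j i
    rcases neg_one_pow_eq_or ℝ m with hm | hm
    · have h1 := occ_even hi hm
      have h2 := occ_odd hj (by rw [pow_succ, hm]; norm_num)
      have hb := best m ((i : ℤ) - j) (l - 1) (by omega) (by omega)
      push_cast at hb hl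
      rw [hm, ← sub_add, ← hl] at hb
      rcases hb with hb | hb <;> linarith [h1.1, h1.2, h2.1, h2.2]
    · have h1 := occ_odd hi hm
      have h2 := occ_even hj (by rw [pow_succ, hm]; norm_num)
      have hb := best m ((i : ℤ) - j) (l + 1) (by omega) (by omega)
      push_cast at hb hl
      rw [hm, ← sub_sub, ← hl] at hb
      rcases hb with hb | hb <;> linarith [h1.1, h1.2, h2.1, h2.2]

/-! ### Attractors in terms of the infinite word -/

/-- the covering condition -/
def Cov (N : ℕ) (Γ : Finset ℕ) : Prop := ∀ s l, 1 ≤ l → s + l ≤ N →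
  ∃ i, i + l ≤ N ∧ (∀ k < l, W (i + k) = W (s + k)) ∧ ∃ z ∈ Γ, i + 1 ≤ z ∧ z ≤ i + l

theorem take_drop_get (n s l : ℕ) (h : s + l ≤ fib (n + 1)) :
    ((F (n + 1)).drop s).take l = (List.range l).map fun k => W (s + k) := by
  apply List.ext_getElem?
  intro k
  by_cases hk : k < l
  · rw [List.getElem?_take_of_lt hk, List.getElem?_drop, F_get n _ (by omega)]
    simp [hk]
  · rw [List.getElem?_eq_none, List.getElem?_eq_none]
    · simp; omega
    · simp; omega

theorem cov_of_attractor {n : ℕ} {Γ : Finset ℕ} (h : IsAttractor (F (n + 1)) Γ) :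
    Cov (fib (n + 1)) Γ := by
  intro s l hl hs
  have hlen : ((List.range l).map fun k => W (s + k)).length = l := by simp
  obtain ⟨i, ⟨h1, h2, h3⟩, z, hz, hz1, hz2⟩ := h.2 ((List.range l).map fun k => W (s + k))
    (by intro h0; rw [h0] at hlen; simp at hlen; omega)
    (by
      rw [← take_drop_get n s l hs]
      exact (List.take_prefix _ _).isInfix.trans (List.drop_suffix _ _).isInfix)
  rw [hlen, length_F] at h2
  rw [hlen] at h3 hz2
  rw [take_drop_get n _ _ (by omega)] at h3
  refine ⟨i - 1, by omega, ?_, z, hz, by omega, by omega⟩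
  intro k hk
  have := congrArg (fun L => L[k]?) h3
  simpa [hk] using this

theorem attractor_of_cov {n : ℕ} {Γ : Finset ℕ} (h0 : ∀ z ∈ Γ, 1 ≤ z ∧ z ≤ fib (n + 1))
    (h : Cov (fib (n + 1)) Γ) : IsAttractor (F (n + 1)) Γ := by
  refine ⟨by rwa [length_F], ?_⟩
  rintro w hw ⟨u, v, huv⟩
  have hlen := congrArg List.length huv
  simp only [List.length_append, length_F] at hlen
  have hwl : 1 ≤ w.length := List.length_pos_iff.mpr hw
  obtain ⟨i, h1, h2, z, hz, hz1, hz2⟩ := h u.length w.length hwl (by omega)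
  refine ⟨i + 1, ⟨by omega, by rw [length_F]; omega, ?_⟩, z, hz, by omega, by omega⟩
  have e : w = (List.range w.length).map fun k => W (u.length + k) := by
    rw [← take_drop_get n u.length w.length (by omega), ← huv]
    simp
  rw [Nat.add_sub_cancel, take_drop_get n i w.length h1]
  conv_rhs => rw [e]
  apply List.map_congr_left
  intro k hk
  exact h2 k (by simpa using hk)

theorem cov_pair (n : ℕ) : Cov (fib (n + 3)) {fib (n + 1), fib (n + 2)} := by
  induction n with
  | zero =>
    intro s l hl hs
    simp only [fib] at hs ⊢
    by_cases h : s ≤ 1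
    · refine ⟨s, hs, fun _ _ => rfl, ?_⟩
      have : s = 0 ∨ s = 1 := by omega
      rcases this with rfl | rfl
      · exact ⟨1, by simp, by omega, by omega⟩
      · exact ⟨2, by simp, by omega, by omega⟩
    · have h1 : s = 2 := by omega
      have h2 : l = 1 := by omega
      subst h1 h2
      refine ⟨0, by omega, ?_, 1, by simp, by omega, by omega⟩
      intro k hk
      obtain rfl : k = 0 := by omega
      simp [W, F]
  | succ n ih =>
    have e2 : fib (n + 1 + 3) = fib (n + 3) + fib (n + 2) := rfl
    have e1 : fib (n + 3) = fib (n + 2) + fib (n + 1) := rfl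
    have e0 : fib (n + 2) = fib (n + 1) + fib n := rfl
    have q0 := fib_pos n
    have q1 := fib_pos (n + 1)
    rw [show n + 1 + 1 = n + 2 from rfl, show n + 1 + 2 = n + 3 from rfl]
    -- the case inside the first part
    have key : ∀ s l, 1 ≤ l → s + l ≤ fib (n + 3) → ∃ i, i + l ≤ fib (n + 1 + 3) ∧
        (∀ k < l, W (i + k) = W (s + k)) ∧
        ∃ z ∈ ({fib (n + 2), fib (n + 3)} : Finset ℕ), i + 1 ≤ z ∧ z ≤ i + l := by
      intro s l hl hs
      obtain ⟨i, h1, h2, z, hz, hz1, hz2⟩ := ih s l hl hs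
      by_cases hc : i + 1 ≤ fib (n + 2) ∧ fib (n + 2) ≤ i + l
      · exact ⟨i, by omega, h2, fib (n + 2), by simp, hc.1, hc.2⟩
      · have hz' : z = fib (n + 1) := by
          simp only [Finset.mem_insert, Finset.mem_singleton] at hz
          rcases hz with hz | hz
          · exact hz
          · subst hz; exact absurd ⟨hz1, hz2⟩ hc
        subst hz'
        have hil : i + l < fib (n + 2) := by omega
        refine ⟨fib (n + 2) + i, by omega, ?_, fib (n + 3), by simp, by omega, by omega⟩
        intro k hk
        rw [add_assoc, W_shift' n (i + k) (by omega)]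
        exact h2 k hk
    intro s l hl hs
    by_cases h1 : s + l ≤ fib (n + 3)
    · exact key s l hl h1
    · by_cases h2 : s < fib (n + 3)
      · exact ⟨s, hs, fun _ _ => rfl, fib (n + 3), by simp, by omega, by omega⟩
      · obtain ⟨t, rfl⟩ := Nat.exists_eq_add_of_le (not_lt.mp h2)
        obtain ⟨i, g1, g2, g3⟩ := key t l hl (by omega)
        refine ⟨i, g1, ?_, g3⟩
        intro k hk
        rw [g2 k hk, add_assoc, W_shift (n + 1) (t + k)]
        rw [show n + 1 + 1 = n + 2 from rfl]
        omega

theorem card_le_two {n : ℕ} {Γ : Finset ℕ} (h : IsSmallestAttractor (F (n + 3)) Γ) :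
    Γ.card ≤ 2 := by
  refine (h.2 {fib (n + 1), fib (n + 2)} (attractor_of_cov (n := n + 2) ?_ (cov_pair n))).trans
    Finset.card_le_two
  have e1 : fib (n + 2 + 1) = fib (n + 2) + fib (n + 1) := rfl
  have q2 := fib_pos (n + 2)
  have q1 := fib_pos (n + 1)
  intro z hz
  simp only [Finset.mem_insert, Finset.mem_singleton] at hz
  rcases hz with rfl | rfl <;> omega

/-! ### The Cantor-like sets -/

def C : ℕ → Finset ℕ
  | 0 => {0}
  | 1 => {0}
  | m + 2 => C m ∪ (C m).image (· + fib (m + 1))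

theorem cov_occ {N m : ℕ} {Γ : Finset ℕ} (h : Cov N Γ) (hN : fib (m + 2) ≤ N) :
    ∃ i, i + fib m ≤ N ∧ Occ m i ∧ ∃ z ∈ Γ, i + 1 ≤ z ∧ z ≤ i + fib m := by
  have e : fib (m + 2) = fib (m + 1) + fib m := rfl
  exact h (fib (m + 1) - 1) (fib m) (fib_pos m) (by omega)

theorem descent {N : ℕ} (m : ℕ) : ∀ x y p q : ℕ, Cov N {x, y} → fib (m + 3) ≤ N →
    Occ (m + 2) p → Occ (m + 1) q → p + 1 ≤ x → x ≤ p + fib (m + 2) →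
    q + 1 ≤ y → y ≤ q + fib (m + 1) →
    (∃ c ∈ C (m + 2), x = p + 1 + c) ∧ (∃ c ∈ C (m + 1), y = q + 1 + c) := by
  induction m with
  | zero =>
    intro x y p q _ _ _ _ h1 h2 h3 h4
    simp only [fib] at h2 h4
    refine ⟨⟨x - p - 1, ?_, by omega⟩, ⟨0, by simp [C], by omega⟩⟩
    have : x - p - 1 = 0 ∨ x - p - 1 = 1 := by omega
    rcases this with h | h <;> rw [h] <;> simp [C, fib]
  | succ m ih =>
    intro x y p q hcov hN hp hq h1 h2 h3 h4
    have e1 : fib (m + 1 + 2) = fib (m + 2) + fib (m + 1) := rfl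
    have e0 : fib (m + 2) = fib (m + 1) + fib m := rfl
    have e2 : fib (m + 1 + 3) = fib (m + 3) + fib (m + 2) := rfl
    have e3 : fib (m + 1 + 1) = fib (m + 2) := rfl
    obtain ⟨i, hiN, hi, z, hz, hz1, hz2⟩ := cov_occ (m := m + 1) hcov
      (by rw [show m + 1 + 2 = m + 3 from rfl]; omega)
    have hzx : z = x := by
      simp only [Finset.mem_insert, Finset.mem_singleton] at hz
      rcases hz with hz | hz
      · exact hz
      · subst hz
        have := occ_disj (by omega) hi hq
        omega
    subst hzx
    have hl := occ_left (by omega) hp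
    have hr := occ_right hp
    have hcase : i = p ∨ i = p + fib (m + 1 + 1) := by
      rcases lt_trichotomy i p with h | h | h
      · have := occ_self_gap hi hl h; omega
      · exact Or.inl h
      · have g1 := occ_self_gap hl hi h
        rcases lt_trichotomy i (p + fib (m + 1 + 1)) with h' | h' | h'
        · omega
        · exact Or.inr h'
        · have := occ_self_gap hr hi h'; omega
    have hcov' : Cov N {y, z} := by rwa [Finset.pair_comm]
    obtain ⟨hy, c, hc, hx⟩ := ih y z q i hcov' (by omega) hq hi h3 h4 hz1 hz2
    refine ⟨?_, hy⟩
    rcases hcase with h | h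
    · exact ⟨c, by rw [C]; exact Finset.mem_union_left _ hc, by omega⟩
    · refine ⟨c + fib (m + 1 + 1), ?_, by omega⟩
      rw [C]
      exact Finset.mem_union_right _ (Finset.mem_image_of_mem _ hc)

theorem mem_LR (k : ℕ) : ∀ c ∈ C (k + 2), fib (k + 3) + c ∈ Lset (k + 2) ∪ Rset (k + 2) := by
  induction k using Nat.twoStepInduction with
  | zero => decide
  | one => decide
  | more k ih _ =>
    intro c hc
    have e : fib (k + 2 + 3) = fib (k + 4) + fib (k + 3) := rfl
    have hL : ∀ d ∈ C (k + 2), fib (k + 2 + 3) + d ∈ Lset (k + 2 + 2) := by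
      intro d hd
      have h1 := ih d hd
      rw [show k + 2 + 2 = k + 4 from rfl, Lset]
      exact Finset.mem_image.mpr ⟨_, h1, by omega⟩
    rw [show k + 2 + 2 = k + 4 from rfl, C] at hc
    rcases Finset.mem_union.mp hc with hc | hc
    · exact Finset.mem_union_left _ (hL c hc)
    · obtain ⟨d, hd, rfl⟩ := Finset.mem_image.mp hc
      refine Finset.mem_union_right _ (Finset.mem_image.mpr ⟨_, hL d hd, ?_⟩)
      rw [show k + 2 + 2 - 1 = k + 3 by omega]
      simp only [show k + 2 + 1 = k + 3 by omega]
      omega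

theorem mem_L (k c : ℕ) (hc : c ∈ C (k + 2)) : fib (k + 5) + c ∈ Lset (k + 4) := by
  have h1 := mem_LR k c hc
  have e : fib (k + 5) = fib (k + 4) + fib (k + 3) := rfl
  rw [Lset]
  exact Finset.mem_image.mpr ⟨_, h1, by omega⟩

theorem mem_L' (k : ℕ) : ∀ c ∈ C (k + 2), c ≤ 1 → fib (k + 3) + c ∈ L'set (k + 2) := by
  induction k using Nat.twoStepInduction with
  | zero => decide
  | one => decide
  | more k ih _ =>
    intro c hc h1
    have e : fib (k + 2 + 3) = fib (k + 4) + fib (k + 3) := rfl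
    rw [show k + 2 + 2 = k + 4 from rfl, C] at hc
    rcases Finset.mem_union.mp hc with hc | hc
    · rw [show k + 2 + 2 = k + 4 from rfl, L'set]
      exact Finset.mem_image.mpr ⟨_, ih c hc h1, by omega⟩
    · obtain ⟨d, hd, rfl⟩ := Finset.mem_image.mp hc
      have := lt_fib_succ (k + 2)
      omega

theorem main_aux (k : ℕ) (hk : 3 ≤ k) (Γ : Finset ℕ) (h : IsSmallestAttractor (F (k + 4)) Γ) :
    (∃ c ∈ C (k + 1), ∃ d ∈ C k, Γ = {fib (k + 2) + c, fib (k + 3) + d}) ∨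
    (∃ c ∈ C (k + 1), c ≤ 1 ∧ ∃ d ∈ C k,
      Γ = {fib (k + 2) + c, fib (k + 3) + d + fib (k + 1)}) := by
  have hcard : Γ.card ≤ 2 := card_le_two (n := k + 1) h
  have hcov : Cov (fib (k + 4)) Γ := cov_of_attractor (n := k + 3) h.1
  have e4 : fib (k + 4) = fib (k + 3) + fib (k + 2) := rfl
  have e3 : fib (k + 3) = fib (k + 2) + fib (k + 1) := rfl
  have e2 : fib (k + 2) = fib (k + 1) + fib k := rfl
  have q0 := fib_pos k
  have q1 := lt_fib_succ k
  -- the occurrence of the longest singular word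
  obtain ⟨j, hjN, hj, y, hy, hy1, hy2⟩ := cov_occ (m := k + 2) hcov le_rfl
  have oj : Occ (k + 2) (fib (k + 3) - 1) := occ_self (k + 2)
  have hj' : j = fib (k + 3) - 1 := by
    rcases lt_trichotomy j (fib (k + 3) - 1) with h | h | h
    · have : j + fib (k + 3) ≤ _ := occ_self_gap hj oj h
      omega
    · exact h
    · have : _ + fib (k + 3) ≤ j := occ_self_gap oj hj h
      omega
  obtain ⟨i, hiN, hi, x, hx, hx1, hx2⟩ := cov_occ (m := k + 1) hcov
    (by rw [show k + 1 + 2 = k + 3 from rfl]; omega)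
  have oi : Occ (k + 1) (fib (k + 2) - 1) := occ_self (k + 1)
  have hi' : i = fib (k + 2) - 1 := by
    rcases lt_trichotomy i (fib (k + 2) - 1) with h | h | h
    · have : i + fib (k + 2) ≤ _ := occ_self_gap hi oi h
      omega
    · exact h
    · have h1 : _ + fib (k + 2) ≤ i := occ_self_gap oi hi h
      have h2 : _ ∨ _ + fib (k + 2) ≤ i := occ_disj (by omega) hi oj
      omega
  subst hi' hj'
  have hne : x ≠ y := by omega
  have hΓ : Γ = {x, y} := by
    symm
    apply Finset.eq_of_subset_of_card_le
    · intro z hz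
      simp only [Finset.mem_insert, Finset.mem_singleton] at hz
      rcases hz with rfl | rfl <;> assumption
    · rw [Finset.card_pair hne]; exact hcard
  subst hΓ
  obtain ⟨k', rfl⟩ := Nat.exists_eq_add_of_le' hk
  obtain ⟨⟨d, hd, hyd⟩, c, hc, hxc⟩ := descent (k' + 3) y x _ _
    (by rwa [Finset.pair_comm]) (by rw [show k' + 3 + 3 + 1 = k' + 3 + 4 from rfl] at *; omega)
    oj oi hy1 hy2 hx1 hx2
  rw [C] at hd
  rcases Finset.mem_union.mp hd with hd | hd
  · left
    refine ⟨c, hc, d, hd, ?_⟩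
    congr 2 <;> omega
  · right
    obtain ⟨d, hd', rfl⟩ := Finset.mem_image.mp hd
    have hc1 : c ≤ 1 := by
      have e1 : fib (k' + 3 + 1) = fib (k' + 3) + fib (k' + 2) := rfl
      have q2 := lt_fib_succ (k' + 1)
      rw [show k' + 1 + 1 = k' + 2 from rfl] at q2
      obtain ⟨i, g1, g2, z, hz, hz1, hz2⟩ := hcov (fib (k' + 3 + 1) - 1) (fib (k' + 3) + 2)
        (by omega) (by omega)
      have ho : Occ (k' + 3) i := fun k hk => g2 k (by omega)
      simp only [Finset.mem_insert, Finset.mem_singleton] at hz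
      rcases hz with rfl | rfl
      · have := occ_disj (by omega) ho oi
        rw [show k' + 3 + 1 + 1 = k' + 3 + 2 from rfl] at this
        omega
      · exfalso
        have orr := occ_right oj
        rcases lt_trichotomy i (fib (k' + 3 + 3) - 1 + fib (k' + 3 + 1)) with h | h | h
        · have := occ_self_gap ho orr h
          omega
        · omega
        · have := occ_self_gap orr ho h
          omega
    refine ⟨c, hc, hc1, d, hd', ?_⟩
    congr 2 <;> omega

/-- For every n ≥ 7,
Att(F_n) ⊆ ((L_{n-3} ∪ R_{n-3}) ⊗ L_{n-2}) ∪ (L'_{n-3} ⊗ R_{n-2}). -/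
theorem fib_att_subset_formula :
    ∀ n : ℕ, 7 ≤ n →
      Att (F n) ⊆
        pairSet (Lset (n - 3) ∪ Rset (n - 3)) (Lset (n - 2)) ∪
          pairSet (L'set (n - 3)) (Rset (n - 2)) := by
  intro n hn Γ hΓ
  obtain ⟨k, rfl⟩ := Nat.exists_eq_add_of_le' hn
  have h : IsSmallestAttractor (F (k + 3 + 4)) Γ := hΓ
  rw [show k + 7 - 3 = k + 4 by omega, show k + 7 - 2 = k + 5 by omega]
  rcases main_aux (k + 3) (by omega) Γ h with ⟨c, hc, d, hd, rfl⟩ | ⟨c, hc, hc1, d, hd, rfl⟩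
  · left
    exact ⟨_, mem_LR (k + 2) c hc, _, mem_L (k + 1) d hd, rfl⟩
  · right
    exact ⟨_, mem_L' (k + 2) c hc hc1, _,
      Finset.mem_image_of_mem _ (mem_L (k + 1) d hd), rfl⟩
end

section
/- For every n ≥ 7, the set of all smallest string attractors of the Fibonacci word F_n is exactly Att(F_n) = ((L_{n-3} ∪ R_{n-3}) ⊗ L_{n-2}) ∪ (L'_{n-3} ⊗ R_{n-2}). -/
namespace FibAtt

/-! Fibonacci numbers -/

theorem fib_add (k : ℕ) : fib (k + 2) = fib (k + 1) + fib k := rfl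

theorem fib_pos (k : ℕ) : 1 ≤ fib k := by
  induction k using Nat.strong_induction_on with
  | _ k ih =>
    match k with
    | 0 => simp [fib]
    | 1 => simp [fib]
    | k + 2 =>
      have := ih (k + 1) (by omega)
      rw [fib_add]; omega

theorem fib_le_succ (k : ℕ) : fib k ≤ fib (k + 1) := by
  match k with
  | 0 => simp [fib]
  | k + 1 => rw [fib_add]; omega

theorem fib_mono {j k : ℕ} (h : j ≤ k) : fib j ≤ fib k :=
  monotone_nat_of_le_succ fib_le_succ h

theorem fib_ge (k : ℕ) : k ≤ fib k := by
  induction k using Nat.strong_induction_on with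
  | _ k ih =>
    match k with
    | 0 => simp
    | 1 => simp [fib]
    | k + 2 =>
      have := ih (k + 1) (by omega)
      have := fib_pos k
      rw [fib_add]; omega

theorem F_length (k : ℕ) : (F k).length = fib k := by
  induction k using Nat.strong_induction_on with
  | _ k ih =>
    match k with
    | 0 => simp [fib, F]
    | 1 => simp [fib, F]
    | k + 2 =>
      have := ih (k + 1) (by omega)
      have := ih k (by omega)
      simp [F, fib_add, *]

/-! The infinite Fibonacci word, 1-based -/

def X (i : ℕ) : Bool := (F (i + 1)).getD (i - 1) true

theorem F_prefix {m n : ℕ} (hm : 1 ≤ m) (h : m ≤ n) : F m <+: F n := by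
  induction n, h using Nat.le_induction with
  | base => exact List.prefix_rfl
  | succ n hn ih =>
    obtain ⟨n, rfl⟩ : ∃ n', n = n' + 1 := ⟨n - 1, by omega⟩
    exact ih.trans (by simp [F])

theorem prefix_getD {a b : List Bool} (h : a <+: b) {i : ℕ} (hi : i < a.length) :
    a.getD i true = b.getD i true := by
  obtain ⟨c, rfl⟩ := h
  simp [List.getD_eq_getElem?_getD, List.getElem?_append, hi]

theorem X_eq {n i : ℕ} (hn : 1 ≤ n) (hi : 1 ≤ i) (h : i ≤ fib n) :
    (F n).getD (i - 1) true = X i := by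
  unfold X
  have h2 := fib_ge (i + 1)
  rcases le_total n (i + 1) with hl | hl
  · exact prefix_getD (F_prefix hn hl) (by rw [F_length]; omega)
  · exact (prefix_getD (F_prefix (by omega) hl) (by rw [F_length]; omega)).symm

theorem X_shift {k t : ℕ} (hk : 1 ≤ k) (ht : 1 ≤ t) (h : t ≤ fib k) :
    X (fib (k + 1) + t) = X t := by
  rw [← X_eq (n := k + 2) (by omega) (by omega) (by rw [fib_add]; omega), ← X_eq hk ht h]
  simp only [F, List.getD_eq_getElem?_getD, List.getElem?_append, F_length]
  rw [if_neg (by omega), show fib (k + 1) + t - 1 - fib (k + 1) = t - 1 by omega]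

theorem X1 : X 1 = false := by decide
theorem X2 : X 2 = true := by decide
theorem X3 : X 3 = false := by decide

theorem X_ends (k : ℕ) : X (fib (k + 2) - 1) = !X (fib (k + 2)) := by
  induction k using Nat.strong_induction_on with
  | _ k ih =>
    match k with
    | 0 => decide
    | 1 => decide
    | k + 2 =>
      have h := ih k (by omega)
      have h1 : fib (k + 4) = fib (k + 3) + fib (k + 2) := rfl
      have h2 : 2 ≤ fib (k + 2) := by have := fib_ge (k + 2); omega
      rw [show fib (k + 2 + 2) = fib (k + 3) + fib (k + 2) from rfl,
        X_shift (by omega) (by omega) le_rfl,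
        show fib (k + 3) + fib (k + 2) - 1 = fib (k + 3) + (fib (k + 2) - 1) by omega,
        X_shift (by omega) (by omega) (by omega), h]

/-! The morphism -/

def phi (b : Bool) : List Bool := if b then [false] else [false, true]

theorem F_phi (n : ℕ) : F (n + 1) = (F n).flatMap phi := by
  induction n using Nat.strong_induction_on with
  | _ k ih =>
    match k with
    | 0 => simp [F, phi]
    | 1 => simp [F, phi]
    | k + 2 =>
      have h1 := ih (k + 1) (by omega)
      have h2 := ih k (by omega)
      have e1 : F (k + 2 + 1) = F (k + 2) ++ F (k + 1) := rfl
      have e2 : F (k + 2) = F (k + 1) ++ F k := rfl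
      have e3 : (F (k + 2)).flatMap phi = (F (k + 1)).flatMap phi ++ (F k).flatMap phi := by
        rw [e2, List.flatMap_append]
      rw [e3, ← h1, ← h2, e1]

def h : ℕ → ℕ
  | 0 => 0
  | s + 1 => h s + (if X (s + 1) then 1 else 2)

theorem h_succ (s : ℕ) : h (s + 1) = h s + (if X (s + 1) then 1 else 2) := rfl

theorem drop_F {n s : ℕ} (hn : 1 ≤ n) (hs : s < fib n) :
    (F n).drop s = X (s + 1) :: (F n).drop (s + 1) := by
  have hl : s < (F n).length := by rw [F_length]; exact hs
  rw [List.drop_eq_getElem_cons hl]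
  congr 1
  rw [← X_eq hn (by omega) (by omega)]
  simp [List.getD_eq_getElem?_getD, hl]

theorem take_F {n s : ℕ} (hn : 1 ≤ n) (hs : s < fib n) :
    (F n).take (s + 1) = (F n).take s ++ [X (s + 1)] := by
  have hl : s < (F n).length := by rw [F_length]; exact hs
  rw [List.take_succ_eq_append_getElem hl]
  congr 2
  rw [← X_eq hn (by omega) (by omega)]
  simp [List.getD_eq_getElem?_getD, hl]

theorem h_eq {n s : ℕ} (hn : 1 ≤ n) (hs : s ≤ fib n) :
    (((F n).take s).flatMap phi).length = h s := by
  induction s with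
  | zero => simp [h]
  | succ s ih =>
    rw [take_F hn hs, List.flatMap_append, List.length_append, ih (by omega), h_succ]
    cases X (s + 1) <;> simp [phi]

theorem h_fib {k : ℕ} (hk : 1 ≤ k) : h (fib k) = fib (k + 1) := by
  rw [← h_eq hk le_rfl, ← F_length, ← F_length, List.take_length, ← F_phi]

theorem F_split {n s : ℕ} (hn : 1 ≤ n) (hs : s < fib n) :
    F (n + 1) = ((F n).take s).flatMap phi ++ (phi (X (s + 1)) ++ ((F n).drop (s + 1)).flatMap phi) := by
  rw [F_phi]
  conv_lhs => rw [← List.take_append_drop s (F n), List.flatMap_append, drop_F hn hs,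
    List.flatMap_cons]

theorem X_h1 (s : ℕ) : X (h s + 1) = false := by
  have hs : s < fib (s + 1) := by have := fib_ge (s + 1); omega
  have h1 := F_split (n := s + 1) (by omega) hs
  have h2 : h s + 1 ≤ fib (s + 2) := by
    rw [← F_length, h1, List.length_append, h_eq (by omega) (by omega), List.length_append]
    cases X (s + 1)
    · simp [phi]; omega
    · simp [phi]
  rw [← X_eq (n := s + 2) (by omega) (by omega) h2, h1]
  simp only [List.getD_eq_getElem?_getD, List.getElem?_append, h_eq (n := s + 1) (s := s) (by omega) (by omega)]
  cases X (s + 1) <;> simp [phi]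

theorem X_h2 {s : ℕ} (hx : X (s + 1) = false) : X (h s + 2) = true := by
  have hs : s < fib (s + 1) := by have := fib_ge (s + 1); omega
  have h1 := F_split (n := s + 1) (by omega) hs
  rw [hx] at h1
  have h2 : h s + 2 ≤ fib (s + 2) := by
    rw [← F_length, h1, List.length_append, h_eq (by omega) (by omega), List.length_append]
    simp [phi]
  rw [← X_eq (n := s + 2) (by omega) (by omega) h2, h1]
  simp only [List.getD_eq_getElem?_getD, List.getElem?_append, h_eq (n := s + 1) (s := s) (by omega) (by omega)]
  simp [phi]

theorem h_succ_a {s : ℕ} (hx : X (s + 1) = false) : h (s + 1) = h s + 2 := by simp [h_succ, hx]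
theorem h_succ_b {s : ℕ} (hx : X (s + 1) = true) : h (s + 1) = h s + 1 := by simp [h_succ, hx]

theorem h_succ_bounds (s : ℕ) : h s + 1 ≤ h (s + 1) ∧ h (s + 1) ≤ h s + 2 := by
  rw [h_succ]; split <;> omega

theorem h_strictMono : StrictMono h := strictMono_nat_of_lt_succ (fun s => (h_succ_bounds s).1)

theorem h_le {a b : ℕ} (hab : a ≤ b) : h a ≤ h b := h_strictMono.monotone hab

theorem h_surj (s : ℕ) : ∃ u, s = h u ∨ (s = h u + 1 ∧ X (u + 1) = false) := by
  induction s with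
  | zero => exact ⟨0, Or.inl rfl⟩
  | succ s ih =>
    obtain ⟨u, rfl | ⟨rfl, hx⟩⟩ := ih
    · cases hx : X (u + 1)
      · exact ⟨u, Or.inr ⟨rfl, hx⟩⟩
      · exact ⟨u + 1, Or.inl (h_succ_b hx).symm⟩
    · exact ⟨u + 1, Or.inl (h_succ_a hx).symm⟩

theorem X_a {s : ℕ} (hx : X (s + 1) = false) : ∃ u, s = h u := by
  obtain ⟨u, rfl | ⟨rfl, hy⟩⟩ := h_surj s
  · exact ⟨u, rfl⟩
  · have := X_h2 hy
    simp_all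

theorem X_b {s : ℕ} (hx : X (s + 1) = true) : ∃ u, s = h u + 1 ∧ X (u + 1) = false := by
  obtain ⟨u, rfl | hy⟩ := h_surj s
  · have := X_h1 u
    simp_all
  · exact ⟨u, hy⟩

theorem no_bb {s : ℕ} (hx : X (s + 1) = true) : X (s + 2) = false := by
  obtain ⟨u, rfl, hy⟩ := X_b hx
  have := X_h1 (u + 1)
  rwa [h_succ_a hy] at this

/-! The offset sets -/

def Y : ℕ → ℕ → Prop
  | 0, _ => True
  | k + 1, s => ∃ r, Y k r ∧ s = h r

theorem Y_h {k r : ℕ} (hr : Y k r) : Y (k + 1) (h r) := ⟨r, hr, rfl⟩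

theorem Y_zero (k : ℕ) : Y k 0 := by
  induction k with
  | zero => trivial
  | succ k ih => exact ⟨0, ih, rfl⟩

theorem Y_anti {k s : ℕ} (hs : Y (k + 1) s) : Y k s := by
  induction k generalizing s with
  | zero => trivial
  | succ k ih =>
    obtain ⟨r, hr, rfl⟩ := hs
    exact Y_h (ih hr)

theorem h_add_of {r N : ℕ} (hp : ∀ t, 1 ≤ t → t ≤ N → X (r + t) = X t) {t : ℕ} (ht : t ≤ N) :
    h (r + t) = h r + h t := by
  induction t with
  | zero => simp [h]
  | succ t ih =>
    have := hp (t + 1) (by omega) ht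
    rw [← add_assoc, h_succ, h_succ, ih (by omega), add_assoc r t 1, this]
    omega

theorem Y_prefix {k s : ℕ} (hs : Y k s) : ∀ t, 1 ≤ t → t + 2 ≤ fib (k + 2) → X (s + t) = X t := by
  induction k generalizing s with
  | zero => intro t h1 h2; simp [fib] at h2; omega
  | succ k ih =>
    obtain ⟨r, hr, rfl⟩ := hs
    have ihr := ih hr
    intro t ht1 ht2
    have hf : h (fib (k + 2)) = fib (k + 1 + 2) := h_fib (by omega)
    have hf2 : 2 ≤ fib (k + 2) := by have := fib_ge (k + 2); omega
    obtain ⟨N, hN⟩ : ∃ N, fib (k + 2) = N + 2 := ⟨fib (k + 2) - 2, by omega⟩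
    have he := X_ends k
    rw [hN] at ihr hf he
    rw [← hf] at ht2
    have b2 := h_succ_bounds (N + 1)
    obtain ⟨u, hu⟩ := h_surj (t - 1)
    have huN : u ≤ N := by
      by_contra hc
      have := h_le (show N + 1 ≤ u by omega)
      have : h (N + 1 + 1) = h (N + 2) := rfl
      omega
    have hadd := h_add_of (r := r) (N := N) (fun t h1 h2 => ihr t h1 (by omega)) huN
    rcases hu with hu | ⟨hu, hx⟩
    · obtain rfl : t = h u + 1 := by omega
      rw [← add_assoc, ← hadd, X_h1, X_h1]
    · obtain rfl : t = h u + 2 := by omega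
      rw [← add_assoc, ← hadd, X_h2 hx, X_h2]
      by_cases hc : u = N
      · subst hc
        have e1 : X (u + 2) = true := by
          rw [show u + 2 - 1 = u + 1 by omega, hx] at he
          simpa using he.symm
        have e2 := h_succ_b e1
        have e3 := h_succ_a hx
        have : h (u + 1 + 1) = h (u + 2) := rfl
        omega
      · rw [add_assoc, ihr (u + 1) (by omega) (by omega), hx]

theorem Y_add {k r t : ℕ} (hr : Y k r) (ht : t + 2 ≤ fib (k + 2)) : h (r + t) = h r + h t :=
  h_add_of (N := fib (k + 2) - 2) (fun t h1 h2 => Y_prefix hr t h1 (by omega)) (by omega)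

theorem Y_add_fib {k j r : ℕ} (hr : Y k r) (hj : 1 ≤ j) (hjk : j ≤ k) :
    h (r + fib j) = h r + fib (j + 1) := by
  rw [Y_add hr, h_fib hj]
  have := fib_mono hjk
  have : 1 ≤ k := by omega
  have : 2 ≤ fib (k + 1) := by have := fib_ge (k + 1); omega
  have := fib_add k
  omega

/-- sets of consecutive levels -/
theorem Y_gap {k s s' : ℕ} (hs : Y k s) (hs' : Y (k + 1) s') (hlt : s' < s) :
    s' + fib (k + 1) ≤ s := by
  induction k generalizing s s' with
  | zero => simpa [fib] using hlt
  | succ k ih =>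
    obtain ⟨u, hu, rfl⟩ := hs
    obtain ⟨u', hu', rfl⟩ := hs'
    have := ih hu hu' (h_strictMono.lt_iff_lt.1 hlt)
    have := h_le this
    rwa [Y_add_fib hu' (by omega) (by omega)] at this

theorem Y_gap' {k s s' : ℕ} (hs : Y (k + 1) s) (hs' : Y (k + 1) s') (hlt : s' < s) :
    s' + fib k ≤ s := by
  induction k generalizing s s' with
  | zero => simpa [fib] using hlt
  | succ k ih =>
    obtain ⟨u, hu, rfl⟩ := hs
    obtain ⟨u', hu', rfl⟩ := hs'
    have h1 := ih hu hu' (h_strictMono.lt_iff_lt.1 hlt)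
    have h2 := h_le h1
    rcases Nat.eq_zero_or_pos k with rfl | hk
    · have := h_succ_bounds u'
      simp [fib] at *
      omega
    · rwa [Y_add_fib hu' hk (by omega)] at h2

theorem Y_sub {k s : ℕ} (hs : Y (k + 2) s) : Y k (s + fib (k + 1)) ∧ Y k (s + fib (k + 2)) := by
  induction k generalizing s with
  | zero => exact ⟨trivial, trivial⟩
  | succ k ih =>
    obtain ⟨r, hr, rfl⟩ := hs
    obtain ⟨h1, h2⟩ := ih hr
    have h1 := Y_h h1
    have h2 := Y_h h2
    rw [Y_add_fib hr (by omega) (by omega)] at h1 h2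
    exact ⟨h1, h2⟩

theorem Y_right {k s : ℕ} (hs : Y k s) : Y (k + 1) s ∨ ∃ r, Y (k + 2) r ∧ s = r + fib (k + 1) := by
  induction k generalizing s with
  | zero =>
    obtain ⟨u, rfl | ⟨rfl, hx⟩⟩ := h_surj s
    · exact Or.inl ⟨u, trivial, rfl⟩
    · obtain ⟨v, rfl⟩ := X_a hx
      exact Or.inr ⟨_, ⟨_, ⟨v, trivial, rfl⟩, rfl⟩, rfl⟩
  | succ k ih =>
    obtain ⟨u, hu, rfl⟩ := hs
    rcases ih hu with h1 | ⟨r, hr, rfl⟩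
    · exact Or.inl (Y_h h1)
    · exact Or.inr ⟨_, Y_h hr, Y_add_fib hr (by omega) (by omega)⟩

theorem Y_left {k s : ℕ} (hs : Y k s) : s = 0 ∨ (∃ r, Y (k + 1) r ∧ s = r + fib (k + 1)) ∨
    ∃ r, Y (k + 2) r ∧ s = r + fib (k + 2) := by
  induction k generalizing s with
  | zero =>
    rcases Nat.eq_zero_or_pos s with h0 | hpos
    · exact Or.inl h0
    obtain ⟨s, rfl⟩ : ∃ s', s = s' + 1 := ⟨s - 1, by omega⟩
    right
    obtain ⟨u, rfl | ⟨rfl, hx⟩⟩ := h_surj s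
    · exact Or.inl ⟨_, ⟨u, trivial, rfl⟩, rfl⟩
    · obtain ⟨v, rfl⟩ := X_a hx
      exact Or.inr ⟨_, ⟨_, ⟨v, trivial, rfl⟩, rfl⟩, rfl⟩
  | succ k ih =>
    obtain ⟨u, hu, rfl⟩ := hs
    rcases ih hu with rfl | ⟨r, hr, rfl⟩ | ⟨r, hr, rfl⟩
    · exact Or.inl rfl
    · exact Or.inr (Or.inl ⟨_, Y_h hr, Y_add_fib hr (by omega) (by omega)⟩)
    · exact Or.inr (Or.inr ⟨_, Y_h hr, Y_add_fib hr (by omega) (by omega)⟩)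

/-- occurrences of the singular words -/
theorem occ_Y (k : ℕ) : ∀ i, 1 ≤ i →
    (∀ t, fib (k + 1) + t < fib (k + 2) → X (i + t) = X (fib (k + 1) + t)) →
    ∃ s, Y (k + 1) s ∧ i = s + fib (k + 1) := by
  induction k with
  | zero =>
    intro i hi hx
    have h0 := hx 0 (by decide)
    obtain ⟨i, rfl⟩ : ∃ j, i = j + 1 := ⟨i - 1, by omega⟩
    have : X (i + 1) = false := by simpa [fib, X1] using h0
    obtain ⟨u, rfl⟩ := X_a this
    exact ⟨_, ⟨u, trivial, rfl⟩, rfl⟩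
  | succ k ih =>
    intro i hi hx
    rcases Nat.eq_zero_or_pos k with rfl | hk
    · have h0 := hx 0 (by decide)
      obtain ⟨i, rfl⟩ : ∃ j, i = j + 1 := ⟨i - 1, by omega⟩
      have : X (i + 1) = true := by simpa [fib, X2] using h0
      obtain ⟨u, rfl, hu⟩ := X_b this
      obtain ⟨v, rfl⟩ := X_a hu
      exact ⟨_, ⟨_, ⟨v, trivial, rfl⟩, rfl⟩, rfl⟩
    have hf1 : h (fib (k + 1)) = fib (k + 2) := h_fib (by omega)
    have hf2 : h (fib (k + 2)) = fib (k + 3) := h_fib (by omega)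
    have hadd : fib (k + 3) = fib (k + 2) + fib (k + 1) := rfl
    have hge : 2 ≤ fib (k + 1) := by have := fib_ge (k + 1); omega
    rw [show k + 1 + 1 = k + 2 from rfl, show k + 1 + 2 = k + 3 from rfl, ← hf1, ← hf2] at hx
    set p := fib (k + 1) with hp
    set q := fib (k + 2) with hq
    have hpq : p ≤ q := fib_le_succ _
    -- i is the end of a block
    obtain ⟨v, hv⟩ : ∃ v, i = h v := by
      obtain ⟨u, hu⟩ := h_surj i
      rcases hu with hu | ⟨rfl, hxu⟩
      · exact ⟨u, hu⟩
      · exfalso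
        have e0 := hx 0 (by omega)
        have e1 := hx 1 (by omega)
        rw [X_h1] at e1
        rw [add_zero, X_h1] at e0
        have := X_h2 hxu
        simp_all
    subst hv
    obtain ⟨v, rfl⟩ : ∃ v', v = v' + 1 := by
      cases v with
      | zero => simp [h] at hi
      | succ v => exact ⟨v, rfl⟩
    have key : ∀ w, X (h (w + 1)) = ! X (w + 1) := by
      intro w
      cases hw : X (w + 1)
      · rw [h_succ_a hw, X_h2 hw]; rfl
      · rw [h_succ_b hw, X_h1]; rfl
    have main : ∀ m, p + m < q → X (v + 1 + m) = X (p + m) ∧ h (v + 1 + m) + h p = h (p + m) + h (v + 1) := by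
      intro m
      induction m with
      | zero =>
        intro hm
        have e0 := hx 0 (by omega)
        obtain ⟨p', hp'⟩ : ∃ p', p = p' + 1 := ⟨p - 1, by omega⟩
        rw [add_zero, add_zero, hp', key, key] at e0
        refine ⟨?_, by simp; omega⟩
        rw [add_zero, add_zero, hp']
        simpa using e0
      | succ m ihm =>
        intro hm
        obtain ⟨i1, i2⟩ := ihm (by omega)
        have hmono : h p ≤ h (p + m) := h_le (by omega)
        obtain ⟨d, hd⟩ : ∃ d, h (p + m) = h p + d := ⟨h (p + m) - h p, by omega⟩
        have hd' : h (v + 1 + m) = h (v + 1) + d := by omega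
        have hqm : h (p + m + 1) < h q := h_strictMono (by omega)
        have heq : X (v + 1 + m + 1) = X (p + m + 1) := by
          have hin : h p + (d + 2) < h q := by
            cases hc : X (p + m + 1)
            · have := h_succ_a hc; omega
            · have h1 := h_succ_b hc
              have h2 := h_succ_a (no_bb hc)
              have h3 : h (p + m + 1 + 1) ≤ h q := h_le (by omega)
              omega
          have e := hx (d + 2) hin
          rw [← add_assoc, ← add_assoc, ← hd, ← hd'] at e
          have sec : ∀ w, X (h w + 2) = ! X (w + 1) := by
            intro w
            cases hw : X (w + 1)
            · rw [X_h2 hw]; rfl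
            · have := X_h1 (w + 1)
              rw [h_succ_b hw] at this
              rw [this]; rfl
          rw [sec, sec] at e
          simpa using e
        refine ⟨heq, ?_⟩
        have a1 := h_succ (v + 1 + m)
        have a2 := h_succ (p + m)
        rw [heq] at a1
        rw [← add_assoc, ← add_assoc]
        omega
    obtain ⟨r, hr, hvr⟩ := ih (v + 1) (by omega) (fun t ht => (main t ht).1)
    refine ⟨h r, Y_h hr, ?_⟩
    rw [hvr, Y_add_fib hr (by omega) (by omega)]


/-! Coverage by singular words -/

def cov (j z : ℕ) : Prop := ∃ s, Y (j + 1) s ∧ s + fib (j + 1) ≤ z ∧ z < s + fib (j + 2)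

theorem cov_disj {j z : ℕ} (h1 : cov j z) (h2 : cov (j + 1) z) : False := by
  obtain ⟨s, hs, a1, a2⟩ := h1
  obtain ⟨s', hs', b1, b2⟩ := h2
  have e1 : fib (j + 3) = fib (j + 2) + fib (j + 1) := rfl
  rw [show j + 1 + 2 = j + 3 from rfl] at b2
  rw [show j + 1 + 1 = j + 2 from rfl] at b1
  have : s' + fib (j + 2) ≤ s := Y_gap hs hs' (by omega)
  omega

/-- relative positions reached by choosing outer thirds all the way down -/
def Ch : ℕ → ℕ → Prop
  | 0, p => p = 0
  | 1, p => p = 0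
  | k + 2, p => Ch k p ∨ ∃ q, p = q + fib (k + 1) ∧ Ch k q

theorem Ch_lt (k : ℕ) : ∀ p, Ch k p → p < fib k := by
  induction k using Nat.strong_induction_on with
  | _ k ih =>
    match k with
    | 0 => intro p hp; simp only [Ch] at hp; simp [hp, fib]
    | 1 => intro p hp; simp only [Ch] at hp; simp [hp, fib]
    | k + 2 =>
      intro p hp
      have e := fib_add k
      rcases hp with hp | ⟨q, rfl, hq⟩
      · have := ih k (by omega) p hp; omega
      · have := ih k (by omega) q hq; omega

theorem Ch_zero (k : ℕ) : Ch k 0 := by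
  induction k using Nat.strong_induction_on with
  | _ k ih =>
    match k with
    | 0 => rfl
    | 1 => rfl
    | k + 2 => exact Or.inl (ih k (by omega))

theorem Ch_cov (j m : ℕ) : ∀ s p, Ch (j + 2 * m) p → Y (j + 2 * m + 1) s →
    ∃ s', Y (j + 1) s' ∧ s' + fib (j + 1) ≤ s + fib (j + 2 * m + 1) + p ∧
      s + fib (j + 2 * m + 1) + p < s' + fib (j + 2) ∧
      s' + fib (j + 2) ≤ s + fib (j + 2 * m + 2) := by
  induction m with
  | zero =>
    intro s p hp hs
    have := Ch_lt _ _ hp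
    have := fib_add j
    exact ⟨s, hs, by simp, by simp at *; omega, le_rfl⟩
  | succ m ih =>
    intro s p hp hs
    rw [show j + 2 * (m + 1) = j + 2 * m + 2 by ring] at *
    set k := j + 2 * m with hk
    obtain ⟨y1, y2⟩ := Y_sub (k := k + 1) hs
    have e1 : fib (k + 3) = fib (k + 2) + fib (k + 1) := rfl
    have e2 : fib (k + 4) = fib (k + 3) + fib (k + 2) := rfl
    have e3 : fib (k + 2 + 1) = fib (k + 3) := rfl
    have e4 : fib (k + 2 + 2) = fib (k + 4) := rfl
    have e5 : fib (k + 1 + 1) = fib (k + 2) := rfl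
    have e6 : fib (k + 1 + 2) = fib (k + 3) := rfl
    rcases hp with hp | ⟨q, rfl, hq⟩
    · obtain ⟨s', h1, h2, h3, h4⟩ := ih _ p hp y1
      exact ⟨s', h1, by omega, by omega, by omega⟩
    · obtain ⟨s', h1, h2, h3, h4⟩ := ih _ q hq y2
      exact ⟨s', h1, by omega, by omega, by omega⟩

theorem cov_Ch (k : ℕ) : ∀ s p, Y (k + 1) s → p < fib k →
    (∀ j m, j + 2 * m = k → cov j (s + fib (k + 1) + p)) → Ch k p := by
  induction k using Nat.strong_induction_on with
  | _ k ih =>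
    match k with
    | 0 => intro s p _ hp _; simp [fib] at hp; exact hp
    | 1 => intro s p _ hp _; simp [fib] at hp; exact hp
    | k + 2 =>
      intro s p hs hp hc
      obtain ⟨y1, y2⟩ := Y_sub (k := k + 1) hs
      have e0 : fib (k + 2) = fib (k + 1) + fib k := rfl
      have e1 : fib (k + 3) = fib (k + 2) + fib (k + 1) := rfl
      have e2 : fib (k + 4) = fib (k + 3) + fib (k + 2) := rfl
      rw [show k + 1 + 1 = k + 2 from rfl] at y1
      rw [show k + 1 + 2 = k + 3 from rfl] at y2
      rw [show k + 2 + 1 = k + 3 from rfl] at hc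
      by_cases c1 : p < fib k
      · left
        refine ih k (by omega) _ p y1 c1 ?_
        intro j m hj
        have := hc j (m + 1) (by omega)
        rwa [show s + fib (k + 2) + fib (k + 1) + p = s + fib (k + 3) + p by omega]
      by_cases c2 : fib (k + 1) ≤ p
      · right
        refine ⟨p - fib (k + 1), by omega, ih k (by omega) _ _ y2 (by omega) ?_⟩
        intro j m hj
        have := hc j (m + 1) (by omega)
        rwa [show s + fib (k + 3) + fib (k + 1) + (p - fib (k + 1)) = s + fib (k + 3) + p by omega]
      · exfalso
        obtain ⟨s', h1, h2, h3⟩ := hc k 1 (by omega)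
        have := Y_gap (Y_anti y2) h1 (by omega)
        omega

theorem Y_edge (d : ℕ) : ∀ k, ∃ s, Y (k + 1) s ∧ s + fib (k + 2) = fib (k + 2 * d + 2) := by
  induction d with
  | zero => intro k; exact ⟨0, Y_zero _, by simp⟩
  | succ d ih =>
    intro k
    obtain ⟨s, hs, he⟩ := ih (k + 2)
    refine ⟨s + fib (k + 3), (Y_sub (k := k + 1) hs).2, ?_⟩
    have e2 : fib (k + 4) = fib (k + 3) + fib (k + 2) := rfl
    have e4 : fib (k + 2 + 2) = fib (k + 4) := rfl
    rw [show k + 2 * (d + 1) + 2 = k + 2 + 2 * d + 2 by ring]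
    omega

theorem core_exists {p q : ℕ} (hp : 1 ≤ p) (hpq : p ≤ q) :
    ∃ k s, Y (k + 1) s ∧ p ≤ s + fib (k + 1) ∧ s + fib (k + 2) ≤ q + 1 ∧
      s < p ∧ q + 2 ≤ s + fib (k + 3) := by
  classical
  let P : ℕ → Prop := fun k => ∃ s, Y (k + 1) s ∧ p ≤ s + fib (k + 1) ∧ s + fib (k + 2) ≤ q + 1
  have hb : ∀ k, P k → k ≤ q := by
    rintro k ⟨s, _, _, h3⟩
    have := fib_ge (k + 2)
    omega
  have hex : ∃ k, P k := by
    obtain ⟨p, rfl⟩ : ∃ p', p = p' + 1 := ⟨p - 1, by omega⟩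
    cases hx : X (p + 1)
    · obtain ⟨u, rfl⟩ := X_a hx
      exact ⟨0, h u, ⟨u, trivial, rfl⟩, by simp [fib], by simp [fib]; omega⟩
    · obtain ⟨u, rfl, hu⟩ := X_b hx
      obtain ⟨v, rfl⟩ := X_a hu
      exact ⟨1, _, ⟨_, ⟨v, trivial, rfl⟩, rfl⟩, by simp [fib], by simp [fib]; omega⟩
  obtain ⟨k0, hk0⟩ := hex
  have hk := Nat.findGreatest_spec (P := P) (hb k0 hk0) hk0
  have hmax : ∀ k', Nat.findGreatest P q < k' → ¬ P k' := fun k' hlt hP =>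
    Nat.findGreatest_is_greatest hlt (hb k' hP) hP
  set k := Nat.findGreatest P q with hkdef
  obtain ⟨s, hs, h1, h2⟩ := hk
  have m1 := hmax (k + 1) (by omega)
  have m2 := hmax (k + 2) (by omega)
  have e1 : fib (k + 2) = fib (k + 1) + fib k := rfl
  have e2 : fib (k + 3) = fib (k + 2) + fib (k + 1) := rfl
  have e3 : fib (k + 4) = fib (k + 3) + fib (k + 2) := rfl
  refine ⟨k, s, hs, h1, h2, ?_, ?_⟩
  · by_contra hc
    rcases Y_left hs with rfl | ⟨r, hr, hsr⟩ | ⟨r, hr, hsr⟩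
    · omega
    · refine m1 ⟨r, hr, ?_, ?_⟩
      · show p ≤ r + fib (k + 2)
        rw [show k + 1 + 1 = k + 2 from rfl] at hsr
        omega
      · show r + fib (k + 3) ≤ q + 1
        rw [show k + 1 + 1 = k + 2 from rfl] at hsr
        omega
    · rw [show k + 1 + 2 = k + 3 from rfl] at hsr
      refine m2 ⟨r, hr, ?_, ?_⟩
      · show p ≤ r + fib (k + 3)
        omega
      · show r + fib (k + 4) ≤ q + 1
        omega
  · by_contra hc
    rcases Y_right hs with hr | ⟨r, hr, hsr⟩
    · refine m1 ⟨s, hr, ?_, ?_⟩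
      · show p ≤ s + fib (k + 2)
        omega
      · show s + fib (k + 3) ≤ q + 1
        omega
    · rw [show k + 1 + 1 = k + 2 from rfl] at hsr
      refine m2 ⟨r, hr, ?_, ?_⟩
      · show p ≤ r + fib (k + 3)
        omega
      · show r + fib (k + 4) ≤ q + 1
        omega

/-! Attractors in terms of X -/

def AttX (n : ℕ) (Γ : Finset ℕ) : Prop :=
  (∀ k ∈ Γ, 1 ≤ k ∧ k ≤ fib n) ∧
  ∀ p m, 1 ≤ p → 1 ≤ m → p + m ≤ fib n + 1 →
    ∃ i, 1 ≤ i ∧ i + m ≤ fib n + 1 ∧ (∀ t, t < m → X (i + t) = X (p + t)) ∧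
      ∃ k ∈ Γ, i ≤ k ∧ k < i + m

theorem sub_eq {n i m : ℕ} (hn : 1 ≤ n) (hi : 1 ≤ i) (him : i + m ≤ fib n + 1) :
    ((F n).drop (i - 1)).take m = (List.range m).map (fun t => X (i + t)) := by
  apply List.ext_getElem
  · simp [F_length]; omega
  · intro t h1 h2
    have ht : t < m := by simpa using h2
    have hl : i - 1 + t < (F n).length := by rw [F_length]; omega
    simp only [List.getElem_take, List.getElem_drop, List.getElem_map, List.getElem_range]
    rw [← X_eq hn (by omega) (by omega), show i + t - 1 = i - 1 + t by omega]
    simp [List.getD_eq_getElem?_getD, hl]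

theorem sub_eq_iff {m i p : ℕ} :
    (List.range m).map (fun t => X (i + t)) = (List.range m).map (fun t => X (p + t)) ↔
      ∀ t, t < m → X (i + t) = X (p + t) := by
  simp

theorem attractor_iff {n : ℕ} (hn : 1 ≤ n) (Γ : Finset ℕ) : IsAttractor (F n) Γ ↔ AttX n Γ := by
  unfold IsAttractor AttX
  rw [F_length]
  refine and_congr_right fun _ => ⟨fun H p m hp hm hpm => ?_, fun H w hw hinf => ?_⟩
  · have hlen : (((F n).drop (p - 1)).take m).length = m := by
      rw [sub_eq hn hp hpm]; simp
    obtain ⟨i, ⟨h1, h2, h3⟩, k, hk, h4, h5⟩ := H (((F n).drop (p - 1)).take m)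
      (by intro h0; rw [h0] at hlen; simp at hlen; omega)
      ((List.take_prefix _ _).isInfix.trans (List.drop_suffix _ _).isInfix)
    rw [hlen] at h2 h3 h5
    rw [F_length] at h2
    rw [sub_eq hn hp hpm, sub_eq hn h1 h2, sub_eq_iff] at h3
    exact ⟨i, h1, h2, h3, k, hk, h4, h5⟩
  · obtain ⟨a, b, hab⟩ := hinf
    have hlen : a.length + w.length + b.length = fib n := by
      rw [← F_length, ← hab]; simp [add_assoc]
    have hwpos : 1 ≤ w.length := List.length_pos_iff.2 hw
    have hweq : ((F n).drop (a.length + 1 - 1)).take w.length = w := by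
      rw [← hab]; simp
    obtain ⟨i, h1, h2, h3, k, hk, h4, h5⟩ := H (a.length + 1) w.length (by omega) hwpos (by omega)
    refine ⟨i, ⟨h1, by rw [F_length]; exact h2, ?_⟩, k, hk, h4, h5⟩
    rw [sub_eq hn h1 h2, sub_eq_iff.2 h3, ← sub_eq hn (by omega) (by omega), hweq]

/-! Sufficiency -/

theorem suff (m a b : ℕ) (ha : Ch (m + 4) a) (hb : Ch (m + 5) b)
    (hab : Ch (m + 3) b ∨ a ≤ 1) : AttX (m + 7) {fib (m + 5) + a, fib (m + 6) + b} := by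
  have e0 : fib (m + 4) = fib (m + 3) + fib (m + 2) := rfl
  have e1 : fib (m + 5) = fib (m + 4) + fib (m + 3) := rfl
  have e2 : fib (m + 6) = fib (m + 5) + fib (m + 4) := rfl
  have e3 : fib (m + 7) = fib (m + 6) + fib (m + 5) := rfl
  have e4 : fib (m + 8) = fib (m + 7) + fib (m + 6) := rfl
  have g2 := fib_ge (m + 2)
  have g3 := fib_ge (m + 3)
  have la := Ch_lt _ _ ha
  have lb := Ch_lt _ _ hb
  refine ⟨?_, ?_⟩
  · intro k hk
    simp only [Finset.mem_insert, Finset.mem_singleton] at hk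
    omega
  intro p l hp hl hpl
  obtain ⟨q, hq⟩ : ∃ q, q + 1 = p + l := ⟨p + l - 1, by omega⟩
  obtain ⟨k, s, hs, h1, h2, h3, h4⟩ := core_exists hp (show p ≤ q by omega)
  have ek2 : fib (k + 2) = fib (k + 1) + fib k := rfl
  have ek3 : fib (k + 3) = fib (k + 2) + fib (k + 1) := rfl
  have fin : ∀ s', Y (k + 1) s' → s' + q ≤ fib (m + 7) + s →
      ∀ z ∈ ({fib (m + 5) + a, fib (m + 6) + b} : Finset ℕ), s' + p ≤ z + s → z + s ≤ q + s' →
      ∃ i, 1 ≤ i ∧ i + l ≤ fib (m + 7) + 1 ∧ (∀ t, t < l → X (i + t) = X (p + t)) ∧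
      ∃ k ∈ ({fib (m + 5) + a, fib (m + 6) + b} : Finset ℕ), i ≤ k ∧ k < i + l := by
    intro s' hs' hroom z hz z1 z2
    refine ⟨s' + (p - s), by omega, by omega, ?_, z, hz, by omega, by omega⟩
    intro t ht
    rw [add_assoc, Y_prefix hs' (p - s + t) (by omega) (by show _ ≤ fib (k + 3); omega),
      ← Y_prefix hs (p - s + t) (by omega) (by show _ ≤ fib (k + 3); omega)]
    congr 1
    omega
  have hk : k ≤ m + 5 := by
    by_contra hc
    have := fib_mono (show m + 8 ≤ k + 2 by omega)
    omega
  have mx : fib (m + 5) + a ∈ ({fib (m + 5) + a, fib (m + 6) + b} : Finset ℕ) := by simp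
  have my : fib (m + 6) + b ∈ ({fib (m + 5) + a, fib (m + 6) + b} : Finset ℕ) := by simp
  rcases Nat.eq_or_lt_of_le hk with rfl | hk
  · rw [show m + 5 + 1 = m + 6 from rfl] at *
    rw [show m + 5 + 2 = m + 7 from rfl] at *
    have hs0 : s = 0 := by
      by_contra hc
      have : 0 + fib (m + 7) ≤ s := Y_gap hs (Y_zero _) (by omega)
      omega
    exact fin s hs (by omega) _ my (by omega) (by omega)
  rcases Nat.eq_or_lt_of_le (show k ≤ m + 4 by omega) with rfl | hk
  · rw [show m + 4 + 1 = m + 5 from rfl] at *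
    rw [show m + 4 + 2 = m + 6 from rfl] at *
    have hs0 : s = 0 := by
      by_contra hc
      have : 0 + fib (m + 6) ≤ s := Y_gap hs (Y_zero _) (by omega)
      omega
    exact fin s hs (by omega) _ mx (by omega) (by omega)
  have hk4 := fib_mono (show k + 1 ≤ m + 4 by omega)
  obtain ⟨d, hd | hd⟩ : ∃ d, k + 2 * d = m + 4 ∨ k + 2 * d = m + 3 := by
    rcases Nat.even_or_odd (m + 4 - k) with ⟨d, hd⟩ | ⟨d, hd⟩
    · exact ⟨d, Or.inl (by omega)⟩
    · exact ⟨d, Or.inr (by omega)⟩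
  · obtain ⟨s', hs', b1, b2, b3⟩ := Ch_cov k d 0 a (by rwa [hd]) (Y_zero _)
    rw [hd] at b1 b2 b3
    rw [show m + 4 + 1 = m + 5 from rfl] at *
    rw [show m + 4 + 2 = m + 6 from rfl] at *
    exact fin s' hs' (by omega) _ mx (by omega) (by omega)
  · obtain ⟨y1, y2⟩ := Y_sub (k := m + 4) (Y_zero _)
    rw [show m + 4 + 1 = m + 5 from rfl] at *
    rw [show m + 4 + 2 = m + 6 from rfl] at *
    by_cases hb3 : Ch (m + 3) b
    · obtain ⟨s', hs', b1, b2, b3⟩ := Ch_cov k d (0 + fib (m + 5)) b (by rwa [hd]) (by rwa [hd])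
      rw [hd] at b1 b2 b3
      rw [show m + 3 + 1 = m + 4 from rfl] at *
      rw [show m + 3 + 2 = m + 5 from rfl] at *
      exact fin s' hs' (by omega) _ my (by omega) (by omega)
    · have ha1 : a ≤ 1 := by tauto
      rcases hb with hb | ⟨b', rfl, hb⟩
      · exact absurd hb hb3
      by_cases hq2 : q ≤ s + fib (k + 2)
      · obtain ⟨s', hs', b1, b2, b3⟩ := Ch_cov k d (0 + fib (m + 6)) b' (by rwa [hd]) (by rwa [hd])
        rw [hd] at b1 b2 b3
        rw [show m + 3 + 1 = m + 4 from rfl] at *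
        rw [show m + 3 + 2 = m + 5 from rfl] at *
        exact fin s' hs' (by omega) _ my (by omega) (by omega)
      · obtain ⟨s', hs', he⟩ := Y_edge d k
        rw [hd] at he
        rw [show m + 3 + 2 = m + 5 from rfl] at *
        exact fin s' hs' (by omega) _ mx (by omega) (by omega)

/-! Necessity -/

theorem hit {m j : ℕ} {Γ : Finset ℕ} (H : AttX (m + 7) Γ) (hj : j ≤ m + 5) :
    ∃ z ∈ Γ, ∃ s, Y (j + 1) s ∧ s + fib (j + 1) ≤ z ∧ z < s + fib (j + 2) ∧
      s + fib (j + 2) ≤ fib (m + 7) + 1 := by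
  have e : fib (j + 2) = fib (j + 1) + fib j := rfl
  have := fib_mono (show j + 2 ≤ m + 7 by omega)
  obtain ⟨i, h1, h2, h3, z, hz, h4, h5⟩ :=
    H.2 (fib (j + 1)) (fib j) (fib_pos _) (fib_pos _) (by omega)
  obtain ⟨s, hs, rfl⟩ := occ_Y j i h1 (fun t ht => h3 t (by omega))
  exact ⟨z, hz, s, hs, h4, by omega, by omega⟩

theorem nec1 {m : ℕ} {Γ : Finset ℕ} (H : AttX (m + 7) Γ) :
    ∃ a b, fib (m + 5) + a ∈ Γ ∧ fib (m + 6) + b ∈ Γ ∧ a < fib (m + 4) ∧ b < fib (m + 5) := by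
  have e0 : fib (m + 4) = fib (m + 3) + fib (m + 2) := rfl
  have e1 : fib (m + 5) = fib (m + 4) + fib (m + 3) := rfl
  have e2 : fib (m + 6) = fib (m + 5) + fib (m + 4) := rfl
  have e3 : fib (m + 7) = fib (m + 6) + fib (m + 5) := rfl
  have g2 := fib_ge (m + 2)
  have g3 := fib_ge (m + 3)
  obtain ⟨x, hx, s, hs, h1, h2, h3⟩ := hit H (show m + 4 ≤ m + 5 by omega)
  obtain ⟨y, hy, s', hs', h1', h2', h3'⟩ := hit H (show m + 5 ≤ m + 5 by omega)
  simp only [Nat.add_assoc, Nat.reduceAdd] at *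
  have hs0 : s = 0 := by
    by_contra hc
    have : 0 + fib (m + 6) ≤ s := Y_gap hs (Y_zero _) (by omega)
    omega
  have hs0' : s' = 0 := by
    by_contra hc
    have : 0 + fib (m + 7) ≤ s' := Y_gap hs' (Y_zero _) (by omega)
    omega
  refine ⟨x - fib (m + 5), y - fib (m + 6), ?_, ?_, by omega, by omega⟩
  · rwa [show fib (m + 5) + (x - fib (m + 5)) = x by omega]
  · rwa [show fib (m + 6) + (y - fib (m + 6)) = y by omega]

theorem nec2 {m a b : ℕ} (H : AttX (m + 7) {fib (m + 5) + a, fib (m + 6) + b})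
    (ha : a < fib (m + 4)) (hb : b < fib (m + 5)) : Ch (m + 4) a ∧ Ch (m + 5) b := by
  have e2 : fib (m + 6) = fib (m + 5) + fib (m + 4) := rfl
  have e3 : fib (m + 7) = fib (m + 6) + fib (m + 5) := rfl
  have hit' : ∀ j ≤ m + 5, cov j (fib (m + 5) + a) ∨ cov j (fib (m + 6) + b) := by
    intro j hj
    obtain ⟨z, hz, s, hs, h1, h2, h3⟩ := hit H hj
    simp only [Finset.mem_insert, Finset.mem_singleton] at hz
    rcases hz with rfl | rfl
    · exact Or.inl ⟨s, hs, h1, h2⟩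
    · exact Or.inr ⟨s, hs, h1, h2⟩
  have chain : ∀ d j, j + 2 * d = m + 4 →
      cov j (fib (m + 5) + a) ∧ cov (j + 1) (fib (m + 6) + b) := by
    intro d
    induction d with
    | zero =>
      intro j hj
      obtain rfl : j = m + 4 := by omega
      exact ⟨⟨0, Y_zero _, by simp, by show _ < 0 + fib (m + 6); omega⟩, ⟨0, Y_zero _, by simp, by show _ < 0 + fib (m + 7); omega⟩⟩
    | succ d ih =>
      intro j hj
      obtain ⟨c1, c2⟩ := ih (j + 2) (by omega)
      have y1 : cov (j + 1) (fib (m + 6) + b) :=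
        (hit' (j + 1) (by omega)).resolve_left (fun hc => cov_disj hc c1)
      exact ⟨(hit' j (by omega)).resolve_right (fun hc => cov_disj hc y1), y1⟩
  constructor
  · refine cov_Ch (m + 4) 0 a (Y_zero _) ha (fun j d hd => ?_)
    rw [zero_add]
    exact (chain d j hd).1
  · refine cov_Ch (m + 5) 0 b (Y_zero _) hb (fun j d hd => ?_)
    rw [zero_add]
    cases j with
    | succ j => exact (chain d j (by omega)).2
    | zero =>
      have c1 := (chain (d - 1) 1 (by omega)).1
      exact (hit' 0 (by omega)).resolve_left (fun hc => cov_disj hc c1)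

theorem nec3 {m a b : ℕ} (H : AttX (m + 7) {fib (m + 5) + a, fib (m + 6) + b})
    (ha : a < fib (m + 4)) (hb : fib (m + 4) ≤ b) : a ≤ 1 := by
  have em : fib (m + 3) = fib (m + 2) + fib (m + 1) := rfl
  have e0 : fib (m + 4) = fib (m + 3) + fib (m + 2) := rfl
  have e1 : fib (m + 5) = fib (m + 4) + fib (m + 3) := rfl
  have e2 : fib (m + 6) = fib (m + 5) + fib (m + 4) := rfl
  have e3 : fib (m + 7) = fib (m + 6) + fib (m + 5) := rfl
  have g1 := fib_ge (m + 1)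
  have g2 := fib_ge (m + 2)
  have g3 := fib_ge (m + 3)
  obtain ⟨i, h1, h2, h3, z, hz, h4, h5⟩ :=
    H.2 (fib (m + 4)) (fib (m + 3) + 2) (by omega) (by omega) (by omega)
  obtain ⟨s, hs, hi⟩ := occ_Y (m + 3) i h1 (fun t ht => h3 t (by
    simp only [Nat.add_assoc, Nat.reduceAdd] at *; omega))
  simp only [Nat.add_assoc, Nat.reduceAdd, Finset.mem_insert, Finset.mem_singleton] at *
  obtain ⟨y1, y2⟩ := Y_sub (k := m + 4) (Y_zero _)
  simp only [Nat.add_assoc, Nat.reduceAdd, zero_add] at y1 y2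
  rcases Nat.eq_zero_or_pos s with rfl | hpos
  · omega
  have a1 : 0 + fib (m + 5) ≤ s := Y_gap hs (Y_zero _) hpos
  have a2 : s + fib (m + 3) ≤ fib (m + 6) := Y_gap' y2 hs (by omega)
  rcases Nat.eq_or_lt_of_le a1 with a3 | a3
  · omega
  · have a4 : fib (m + 5) + fib (m + 3) ≤ s := Y_gap' hs y1 (by omega)
    omega

/-! The position sets -/

theorem mem_U (k : ℕ) : ∀ z, z ∈ Lset (k + 2) ∪ Rset (k + 2) ↔
    ∃ p, Ch (k + 2) p ∧ z = fib (k + 3) + p := by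
  induction k using Nat.strong_induction_on with
  | _ k ih =>
    match k with
    | 0 =>
      intro z
      simp [Lset, Rset, fib, Ch]
    | 1 =>
      intro z
      simp [Lset, Rset, fib, Ch]
    | k + 2 =>
      intro z
      have ihk := ih k (by omega)
      have hL : ∀ z, z ∈ Lset (k + 4) ↔ ∃ p, Ch (k + 2) p ∧ z = fib (k + 5) + p := by
        intro z
        have : Lset (k + 4) = (Lset (k + 2) ∪ Rset (k + 2)).image (· + fib (k + 4)) := rfl
        have e : fib (k + 5) = fib (k + 4) + fib (k + 3) := rfl
        rw [this, Finset.mem_image]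
        constructor
        · rintro ⟨y, hy, rfl⟩
          obtain ⟨p, hp, rfl⟩ := (ihk y).1 hy
          exact ⟨p, hp, by omega⟩
        · rintro ⟨p, hp, rfl⟩
          exact ⟨_, (ihk _).2 ⟨p, hp, rfl⟩, by omega⟩
      rw [Finset.mem_union, show k + 2 + 2 = k + 4 from rfl, show k + 2 + 3 = k + 5 from rfl, hL]
      have : Rset (k + 4) = (Lset (k + 4)).image (· + fib (k + 3)) := rfl
      rw [this, Finset.mem_image]
      constructor
      · rintro (⟨p, hp, rfl⟩ | ⟨y, hy, rfl⟩)
        · exact ⟨p, Or.inl hp, rfl⟩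
        · obtain ⟨p, hp, rfl⟩ := (hL y).1 hy
          exact ⟨p + fib (k + 3), Or.inr ⟨p, rfl, hp⟩, by omega⟩
      · rintro ⟨p, hp | ⟨q, rfl, hq⟩, rfl⟩
        · exact Or.inl ⟨p, hp, rfl⟩
        · exact Or.inr ⟨_, (hL _).2 ⟨q, hq, rfl⟩, by show _ + _ + fib (k + 3) = _ + (_ + fib (k + 3)); omega⟩

theorem mem_L (k : ℕ) (z : ℕ) : z ∈ Lset (k + 4) ↔ ∃ p, Ch (k + 2) p ∧ z = fib (k + 5) + p := by
  have ihk := mem_U k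
  have : Lset (k + 4) = (Lset (k + 2) ∪ Rset (k + 2)).image (· + fib (k + 4)) := rfl
  have e : fib (k + 5) = fib (k + 4) + fib (k + 3) := rfl
  rw [this, Finset.mem_image]
  constructor
  · rintro ⟨y, hy, rfl⟩
    obtain ⟨p, hp, rfl⟩ := (ihk y).1 hy
    exact ⟨p, hp, by omega⟩
  · rintro ⟨p, hp, rfl⟩
    exact ⟨_, (ihk _).2 ⟨p, hp, rfl⟩, by omega⟩

theorem mem_R (k : ℕ) (z : ℕ) :
    z ∈ Rset (k + 4) ↔ ∃ p, Ch (k + 2) p ∧ z = fib (k + 5) + (p + fib (k + 3)) := by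
  have : Rset (k + 4) = (Lset (k + 4)).image (· + fib (k + 3)) := rfl
  rw [this, Finset.mem_image]
  constructor
  · rintro ⟨y, hy, rfl⟩
    obtain ⟨p, hp, rfl⟩ := (mem_L k y).1 hy
    exact ⟨p, hp, by omega⟩
  · rintro ⟨p, hp, rfl⟩
    exact ⟨_, (mem_L k _).2 ⟨p, hp, rfl⟩, by omega⟩

theorem mem_L' (k : ℕ) : ∀ z, z ∈ L'set (k + 2) ↔
    ∃ p, p ≤ 1 ∧ Ch (k + 2) p ∧ z = fib (k + 3) + p := by
  induction k using Nat.strong_induction_on with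
  | _ k ih =>
    match k with
    | 0 =>
      intro z
      simp only [L'set, fib, Ch, Finset.mem_insert, Finset.mem_singleton]
      constructor
      · rintro (rfl | rfl)
        · exact ⟨0, by simp⟩
        · exact ⟨1, by simp⟩
      · rintro ⟨p, hp, -, rfl⟩
        omega
    | 1 =>
      intro z
      simp only [L'set, fib, Ch, Finset.mem_singleton]
      constructor
      · rintro rfl
        exact ⟨0, by simp⟩
      · rintro ⟨p, hp, h | ⟨q, hq, -⟩, rfl⟩ <;> omega
    | k + 2 =>
      intro z
      have ihk := ih k (by omega)
      have : L'set (k + 2 + 2) = (L'set (k + 2)).image (· + fib (k + 4)) := rfl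
      have e : fib (k + 2 + 3) = fib (k + 4) + fib (k + 3) := rfl
      have g := fib_ge (k + 3)
      rw [this, Finset.mem_image]
      constructor
      · rintro ⟨y, hy, rfl⟩
        obtain ⟨p, hp1, hp, rfl⟩ := (ihk y).1 hy
        exact ⟨p, hp1, Or.inl hp, by omega⟩
      · rintro ⟨p, hp1, hp | ⟨q, hq, -⟩, rfl⟩
        · exact ⟨_, (ihk _).2 ⟨p, hp1, hp, rfl⟩, by omega⟩
        · exfalso
          rw [show k + 2 + 1 = k + 3 from rfl] at hq
          omega

theorem card_ge {m : ℕ} {Γ : Finset ℕ} (H : AttX (m + 7) Γ) : 2 ≤ Γ.card := by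
  obtain ⟨a, b, ha, hb, la, lb⟩ := nec1 H
  have e2 : fib (m + 6) = fib (m + 5) + fib (m + 4) := rfl
  have : ({fib (m + 5) + a, fib (m + 6) + b} : Finset ℕ) ⊆ Γ := by
    intro z hz
    simp only [Finset.mem_insert, Finset.mem_singleton] at hz
    rcases hz with rfl | rfl <;> assumption
  have h2 := Finset.card_le_card this
  rwa [Finset.card_pair (by omega)] at h2

theorem mem_Att (m : ℕ) (Γ : Finset ℕ) : Γ ∈ Att (F (m + 7)) ↔
    ∃ a b, Γ = {fib (m + 5) + a, fib (m + 6) + b} ∧ Ch (m + 4) a ∧ Ch (m + 5) b ∧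
      (Ch (m + 3) b ∨ a ≤ 1) := by
  have e2 : fib (m + 6) = fib (m + 5) + fib (m + 4) := rfl
  show IsSmallestAttractor _ _ ↔ _
  unfold IsSmallestAttractor
  constructor
  · rintro ⟨H, hmin⟩
    rw [attractor_iff (by omega)] at H
    obtain ⟨a, b, ha, hb, la, lb⟩ := nec1 H
    have h0 := hmin _ ((attractor_iff (by omega) _).2
      (suff m 0 0 (Ch_zero _) (Ch_zero _) (Or.inl (Ch_zero _))))
    have hΓ : ({fib (m + 5) + a, fib (m + 6) + b} : Finset ℕ) = Γ := by
      apply Finset.eq_of_subset_of_card_le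
      · intro z hz
        simp only [Finset.mem_insert, Finset.mem_singleton] at hz
        rcases hz with rfl | rfl <;> assumption
      · rw [Finset.card_pair (by omega)]
        exact h0.trans Finset.card_le_two
    subst hΓ
    obtain ⟨ca, cb⟩ := nec2 H la lb
    refine ⟨a, b, rfl, ca, cb, ?_⟩
    rcases cb with cb | ⟨q, rfl, _⟩
    · exact Or.inl cb
    · exact Or.inr (nec3 H la (by show fib (m + 4) ≤ q + fib (m + 4); omega))
  · rintro ⟨a, b, rfl, ca, cb, hab⟩
    refine ⟨(attractor_iff (by omega) _).2 (suff m a b ca cb hab), fun Γ' H' => ?_⟩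
    exact Finset.card_le_two.trans (card_ge ((attractor_iff (by omega) _).1 H'))

end FibAtt

/-- For every n ≥ 7,
Att(F_n) = ((L_{n-3} ∪ R_{n-3}) ⊗ L_{n-2}) ∪ (L'_{n-3} ⊗ R_{n-2}). -/
theorem fib_att_characterization :
    ∀ n : ℕ, 7 ≤ n →
      Att (F n) =
        pairSet (Lset (n - 3) ∪ Rset (n - 3)) (Lset (n - 2)) ∪
          pairSet (L'set (n - 3)) (Rset (n - 2)) := by
  intro n hn
  obtain ⟨m, rfl⟩ : ∃ m, n = m + 7 := ⟨n - 7, by omega⟩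
  rw [show m + 7 - 3 = m + 4 from rfl, show m + 7 - 2 = m + 5 from rfl]
  ext Γ
  rw [FibAtt.mem_Att]
  constructor
  · rintro ⟨a, b, rfl, ca, cb, hab⟩
    by_cases hb3 : FibAtt.Ch (m + 3) b
    · left
      exact ⟨_, (FibAtt.mem_U (m + 2) _).2 ⟨a, ca, rfl⟩, _,
        (FibAtt.mem_L (m + 1) _).2 ⟨b, hb3, rfl⟩, rfl⟩
    · right
      rcases cb with cb | ⟨q, rfl, hq⟩
      · exact absurd cb hb3
      · exact ⟨_, (FibAtt.mem_L' (m + 2) _).2 ⟨a, hab.resolve_left hb3, ca, rfl⟩, _,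
          (FibAtt.mem_R (m + 1) _).2 ⟨q, hq, rfl⟩, rfl⟩
  · rintro (⟨x, hx, y, hy, rfl⟩ | ⟨x, hx, y, hy, rfl⟩)
    · obtain ⟨a, ca, rfl⟩ := (FibAtt.mem_U (m + 2) _).1 hx
      obtain ⟨b, cb, rfl⟩ := (FibAtt.mem_L (m + 1) _).1 hy
      exact ⟨a, b, rfl, ca, Or.inl cb, Or.inl cb⟩
    · obtain ⟨a, ha, ca, rfl⟩ := (FibAtt.mem_L' (m + 2) _).1 hx
      obtain ⟨b, cb, rfl⟩ := (FibAtt.mem_R (m + 1) _).1 hy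
      exact ⟨a, _, rfl, ca, Or.inr ⟨b, rfl, cb⟩, Or.inr ha⟩
end
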